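/- Let Ω ⊂ ℝⁿ be an (ε,δ)-domain, λ := λ_{ε,δ}, and f ∈ bmo_λ(Ω). Then the following are equivalent: (a) there exist functions f_k ∈ bmo_λ(Ω) with compact support contained in Ω such that ‖f − f_k‖_{bmo_λ(Ω)} → 0; (b) f vanishes at the boundary, i.e., lim_{t→0⁺} ‖f‖_{bmo_λ(Ω ∖ Ω̊_t)} = 0, and f vanishes at infinity, i.e., lim_{R→∞} ‖f‖_{bmo_λ(Ω ∖ closure(B(0,R)))} = 0. -/

import Mathlib

open MeasureTheory Metric Filter Topology

noncomputable section

/-- A closed axis-parallel cube in ℝⁿ: a closed ball in the sup norm with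
positive radius (`half` = half the sidelength). -/
structure Cube (n : ℕ) where
  center : Fin n → ℝ
  half : ℝ
  half_pos : 0 < half

namespace Cube

variable {n : ℕ}

/-- The underlying set of a cube. -/
def toSet (Q : Cube n) : Set (Fin n → ℝ) := Metric.closedBall Q.center Q.half

/-- The sidelength ℓ(Q). -/
def side (Q : Cube n) : ℝ := 2 * Q.half

/-- The mean f_Q of f over Q. -/
def avg (Q : Cube n) (f : (Fin n → ℝ) → ℝ) : ℝ := ⨍ x in Q.toSet, f x

/-- Mean oscillation of f over Q. -/
def osc (Q : Cube n) (f : (Fin n → ℝ) → ℝ) : ℝ := ⨍ x in Q.toSet, |f x - Q.avg f|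

/-- The mean |f|_Q of |f| over Q. -/
def avgAbs (Q : Cube n) (f : (Fin n → ℝ) → ℝ) : ℝ := ⨍ x in Q.toSet, |f x|

/-- Distance from the cube to the origin. -/
def distToOrigin (Q : Cube n) : ℝ := Metric.infDist (0 : Fin n → ℝ) Q.toSet

/-- The cube 2Q, concentric with Q and of twice the sidelength. -/
def double (Q : Cube n) : Cube n := ⟨Q.center, 2 * Q.half, mul_pos two_pos Q.half_pos⟩

end Cube

variable {n : ℕ}

/-- The modulus of mean oscillation ω_U(f,t): the supremum of the mean oscillation
of f over cubes Q ⊆ U of sidelength < t. -/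
def omegaOn (U : Set (Fin n → ℝ)) (f : (Fin n → ℝ) → ℝ) (t : ℝ) : ℝ :=
  sSup {r | ∃ Q : Cube n, Q.toSet ⊆ U ∧ Q.side < t ∧ r = Q.osc f}

/-- sup{ |f|_Q : Q ⊆ U, ℓ(Q) ≥ lam }. -/
def bigAvgSup (U : Set (Fin n → ℝ)) (lam : ℝ) (f : (Fin n → ℝ) → ℝ) : ℝ :=
  sSup {r | ∃ Q : Cube n, Q.toSet ⊆ U ∧ lam ≤ Q.side ∧ r = Q.avgAbs f}

/-- The nonhomogeneous norm ‖f‖_{bmo_lam(U)}. -/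
def bmoNorm (U : Set (Fin n → ℝ)) (lam : ℝ) (f : (Fin n → ℝ) → ℝ) : ℝ :=
  omegaOn U f lam + bigAvgSup U lam f

/-- Membership in bmo_lam(U): integrable on every cube in U and finite norm. -/
def MemBmo (U : Set (Fin n → ℝ)) (lam : ℝ) (f : (Fin n → ℝ) → ℝ) : Prop :=
  (∀ Q : Cube n, Q.toSet ⊆ U → IntegrableOn f Q.toSet) ∧
  BddAbove {r | ∃ Q : Cube n, Q.toSet ⊆ U ∧ Q.side < lam ∧ r = Q.osc f} ∧
  BddAbove {r | ∃ Q : Cube n, Q.toSet ⊆ U ∧ lam ≤ Q.side ∧ r = Q.avgAbs f}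

/-- Sarason's vanishing mean oscillation condition: ω_U(f,t) → 0 as t → 0⁺. -/
def VanishSmallOsc (U : Set (Fin n → ℝ)) (f : (Fin n → ℝ) → ℝ) : Prop :=
  Tendsto (fun t => omegaOn U f t) (nhdsWithin 0 (Set.Ioi 0)) (nhds 0)

/-- f is bounded on U. -/
def BoundedOn (U : Set (Fin n → ℝ)) (f : (Fin n → ℝ) → ℝ) : Prop :=
  ∃ M : ℝ, ∀ x ∈ U, |f x| ≤ M

/-- f is Lipschitz on U. -/
def LipschitzOn (U : Set (Fin n → ℝ)) (f : (Fin n → ℝ) → ℝ) : Prop :=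
  ∃ K : NNReal, LipschitzOnWith K f U

/-- dist(supp f, ∂U) > 0. -/
def SuppAway (U : Set (Fin n → ℝ)) (f : (Fin n → ℝ) → ℝ) : Prop :=
  ∃ d > 0, ∀ x ∈ Function.support f, ∀ y ∈ frontier U, d ≤ dist x y

/-- The nonhomogeneous Lipschitz norm ‖f‖_{Lip_b(U)} = ‖f‖_∞ + Lipschitz seminorm. -/
def lipbNorm (U : Set (Fin n → ℝ)) (f : (Fin n → ℝ) → ℝ) : ℝ :=
  sSup {r | ∃ x ∈ U, r = |f x|} +
  sSup {r | ∃ x ∈ U, ∃ y ∈ U, x ≠ y ∧ r = |f x - f y| / dist x y}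

/-- U is a domain: a nonempty open connected subset of ℝⁿ. -/
def IsRealDomain (U : Set (Fin n → ℝ)) : Prop := IsOpen U ∧ IsConnected U

/-- U is an (ε,δ)-domain. -/
def IsEpsDeltaDomain (U : Set (Fin n → ℝ)) (ε δ : ℝ) : Prop :=
  ∀ x ∈ U, ∀ y ∈ U, dist x y < δ →
    ∃ γ : ℝ → (Fin n → ℝ), ContinuousOn γ (Set.Icc 0 1) ∧ γ 0 = x ∧ γ 1 = y ∧
      (∀ t ∈ Set.Icc (0:ℝ) 1, γ t ∈ U) ∧
      eVariationOn γ (Set.Icc 0 1) ≤ ENNReal.ofReal (ε⁻¹ * dist x y) ∧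
      ∀ t ∈ Set.Icc (0:ℝ) 1,
        ε * (dist (γ t) x * dist (γ t) y) / dist x y ≤ Metric.infDist (γ t) (frontier U)

/-- The natural scale λ_{ε,δ} for an (ε,δ)-domain. -/
def lamED (n : ℕ) (ε δ : ℝ) : ℝ := ε ^ 2 * δ / (320 * n * (1 + Real.sqrt n * ε))

/-- d_Ω(x) = dist(x,∂Ω). -/
def distBd (U : Set (Fin n → ℝ)) (x : Fin n → ℝ) : ℝ := Metric.infDist x (frontier U)

/-- Ω̊_t = {x ∈ Ω : d_Ω(x) ≥ t}. -/
def innerPart (U : Set (Fin n → ℝ)) (t : ℝ) : Set (Fin n → ℝ) :=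
  {x ∈ U | t ≤ distBd U x}

/-- f vanishes at infinity in the bmo_lam(U) sense. -/
def VanishAtInfinity (U : Set (Fin n → ℝ)) (lam : ℝ) (f : (Fin n → ℝ) → ℝ) : Prop :=
  Tendsto (fun R => bmoNorm (U \ Metric.closedBall 0 R) lam f) atTop (nhds 0)

/-- f vanishes at the boundary in the bmo_lam(U) sense. -/
def VanishAtBoundary (U : Set (Fin n → ℝ)) (lam : ℝ) (f : (Fin n → ℝ) → ℝ) : Prop :=
  Tendsto (fun t => bmoNorm (U \ innerPart U t) lam f) (nhdsWithin 0 (Set.Ioi 0)) (nhds 0)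

/-- f is in the bmo_lam(U)-closure of the continuous functions with compact support in U. -/
def InCmoClosure (U : Set (Fin n → ℝ)) (lam : ℝ) (f : (Fin n → ℝ) → ℝ) : Prop :=
  ∃ g : ℕ → (Fin n → ℝ) → ℝ,
    (∀ j, Continuous (g j) ∧ HasCompactSupport (g j) ∧ tsupport (g j) ⊆ U) ∧
    Tendsto (fun j => bmoNorm U lam (f - g j)) atTop (nhds 0)

/-- The homogeneous BMO(ℝⁿ) seminorm: sup of mean oscillation over all cubes. -/
def bmoHNorm (f : (Fin n → ℝ) → ℝ) : ℝ := sSup {r | ∃ Q : Cube n, r = Q.osc f}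

namespace Cube

lemma side_pos (Q : Cube n) : 0 < Q.side := mul_pos two_pos Q.half_pos

lemma measurableSet_toSet (Q : Cube n) : MeasurableSet Q.toSet := isClosed_closedBall.measurableSet

lemma center_mem (Q : Cube n) : Q.center ∈ Q.toSet := mem_closedBall_self Q.half_pos.le

lemma volume_toSet (Q : Cube n) : volume Q.toSet = ENNReal.ofReal ((2 * Q.half) ^ n) := by
  have := Real.volume_pi_closedBall Q.center Q.half_pos.le
  rwa [Fintype.card_fin] at this

lemma volume_real_toSet (Q : Cube n) : volume.real Q.toSet = (2 * Q.half) ^ n := by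
  have := Q.half_pos
  rw [Measure.real, volume_toSet, ENNReal.toReal_ofReal (by positivity)]

/-- The uniform probability measure on a cube. -/
def unif (Q : Cube n) : Measure (Fin n → ℝ) :=
  (volume.restrict Q.toSet Set.univ)⁻¹ • volume.restrict Q.toSet

lemma volume_restrict_univ (Q : Cube n) :
    volume.restrict Q.toSet Set.univ = ENNReal.ofReal ((2 * Q.half) ^ n) := by
  rw [Measure.restrict_apply_univ, volume_toSet]

lemma volume_restrict_univ_ne_zero (Q : Cube n) : volume.restrict Q.toSet Set.univ ≠ 0 := by
  have := Q.half_pos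
  rw [volume_restrict_univ]
  simpa using (by positivity : 0 < (2 * Q.half) ^ n)

lemma volume_restrict_univ_ne_top (Q : Cube n) : volume.restrict Q.toSet Set.univ ≠ ⊤ := by
  rw [volume_restrict_univ]
  exact ENNReal.ofReal_ne_top

instance (Q : Cube n) : IsProbabilityMeasure Q.unif :=
  ⟨by
    rw [unif, Measure.smul_apply, smul_eq_mul]
    exact ENNReal.inv_mul_cancel Q.volume_restrict_univ_ne_zero Q.volume_restrict_univ_ne_top⟩

lemma integrable_unif (Q : Cube n) {F : (Fin n → ℝ) → ℝ} (h : IntegrableOn F Q.toSet) :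
    Integrable F Q.unif :=
  Integrable.smul_measure h (ENNReal.inv_ne_top.2 Q.volume_restrict_univ_ne_zero)

lemma ae_unif_of_ae (Q : Cube n) {p : (Fin n → ℝ) → Prop} (h : ∀ᵐ x, p x) :
    ∀ᵐ x ∂Q.unif, p x :=
  Measure.ae_smul_measure (ae_restrict_of_ae h) _

lemma ae_mem_unif (Q : Cube n) : ∀ᵐ x ∂Q.unif, x ∈ Q.toSet :=
  Measure.ae_smul_measure (ae_restrict_mem Q.measurableSet_toSet) _

lemma integral_unif (Q : Cube n) (F : (Fin n → ℝ) → ℝ) :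
    ∫ x, F x ∂Q.unif = ((2 * Q.half) ^ n)⁻¹ * ∫ x in Q.toSet, F x := by
  rw [← volume_real_toSet, ← smul_eq_mul, ← setAverage_eq]
  rfl

lemma avg_eq (Q : Cube n) (f : (Fin n → ℝ) → ℝ) : Q.avg f = ∫ x, f x ∂Q.unif := rfl

lemma osc_eq (Q : Cube n) (f : (Fin n → ℝ) → ℝ) :
    Q.osc f = ∫ x, |f x - Q.avg f| ∂Q.unif := rfl

lemma avgAbs_eq (Q : Cube n) (f : (Fin n → ℝ) → ℝ) : Q.avgAbs f = ∫ x, |f x| ∂Q.unif := rfl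

lemma osc_nonneg (Q : Cube n) (f : (Fin n → ℝ) → ℝ) : 0 ≤ Q.osc f :=
  integral_nonneg fun _ => abs_nonneg _

lemma avgAbs_nonneg (Q : Cube n) (f : (Fin n → ℝ) → ℝ) : 0 ≤ Q.avgAbs f :=
  integral_nonneg fun _ => abs_nonneg _

lemma integral_unif_congr (Q : Cube n) {F G : (Fin n → ℝ) → ℝ} (h : ∀ x ∈ Q.toSet, F x = G x) :
    ∫ x, F x ∂Q.unif = ∫ x, G x ∂Q.unif :=
  integral_congr_ae (Q.ae_mem_unif.mono h)

lemma integral_unif_mono (Q : Cube n) {F G : (Fin n → ℝ) → ℝ} (hF : IntegrableOn F Q.toSet)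
    (hG : IntegrableOn G Q.toSet) (h : ∀ x ∈ Q.toSet, F x ≤ G x) :
    ∫ x, F x ∂Q.unif ≤ ∫ x, G x ∂Q.unif :=
  integral_mono_ae (Q.integrable_unif hF) (Q.integrable_unif hG) (Q.ae_mem_unif.mono h)

lemma avg_congr (Q : Cube n) {F G : (Fin n → ℝ) → ℝ} (h : ∀ x ∈ Q.toSet, F x = G x) :
    Q.avg F = Q.avg G := Q.integral_unif_congr h

lemma osc_congr (Q : Cube n) {F G : (Fin n → ℝ) → ℝ} (h : ∀ x ∈ Q.toSet, F x = G x) :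
    Q.osc F = Q.osc G := by
  rw [osc_eq, osc_eq, Q.avg_congr h]
  exact Q.integral_unif_congr fun x hx => by rw [h x hx]

lemma avgAbs_congr (Q : Cube n) {F G : (Fin n → ℝ) → ℝ} (h : ∀ x ∈ Q.toSet, F x = G x) :
    Q.avgAbs F = Q.avgAbs G :=
  Q.integral_unif_congr fun x hx => by rw [h x hx]

lemma integrableOn_const (Q : Cube n) (c : ℝ) : IntegrableOn (fun _ => c) Q.toSet :=
  MeasureTheory.integrableOn_const (by rw [volume_toSet]; exact ENNReal.ofReal_ne_top)

lemma abs_avg_le (Q : Cube n) (f : (Fin n → ℝ) → ℝ) : |Q.avg f| ≤ Q.avgAbs f :=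
  abs_integral_le_integral_abs

lemma abs_avg_sub_le (Q : Cube n) {f : (Fin n → ℝ) → ℝ} (hf : IntegrableOn f Q.toSet) (c : ℝ) :
    |Q.avg f - c| ≤ ∫ x, |f x - c| ∂Q.unif := by
  have : Q.avg f - c = ∫ x, (f x - c) ∂Q.unif := by
    rw [integral_sub (Q.integrable_unif hf) (integrable_const c)]
    simp [avg_eq]
  rw [this]
  exact abs_integral_le_integral_abs

lemma integrable_unif_abs_sub_const (Q : Cube n) {f : (Fin n → ℝ) → ℝ}
    (hf : IntegrableOn f Q.toSet) (c : ℝ) : Integrable (fun x => |f x - c|) Q.unif :=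
  ((Q.integrable_unif hf).sub (integrable_const c)).abs

lemma osc_le_two_mul (Q : Cube n) {f : (Fin n → ℝ) → ℝ} (hf : IntegrableOn f Q.toSet) (c : ℝ) :
    Q.osc f ≤ 2 * ∫ x, |f x - c| ∂Q.unif := by
  have hi := Q.integrable_unif hf
  have h1 : Q.osc f ≤ ∫ x, (|f x - c| + |Q.avg f - c|) ∂Q.unif := by
    refine integral_mono (Q.integrable_unif_abs_sub_const hf _)
      ((Q.integrable_unif_abs_sub_const hf _).add (integrable_const _)) fun x => ?_
    have := abs_sub_le (f x) c (Q.avg f)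
    rwa [abs_sub_comm c] at this
  rw [integral_add (Q.integrable_unif_abs_sub_const hf _) (integrable_const _)] at h1
  have := Q.abs_avg_sub_le hf c
  simp only [integral_const, probReal_univ, one_smul] at h1
  linarith

lemma osc_le_two_mul_avgAbs (Q : Cube n) {f : (Fin n → ℝ) → ℝ} (hf : IntegrableOn f Q.toSet) :
    Q.osc f ≤ 2 * Q.avgAbs f := by
  simpa [avgAbs_eq] using Q.osc_le_two_mul hf 0

lemma avgAbs_le_osc_add (Q : Cube n) {f : (Fin n → ℝ) → ℝ} (hf : IntegrableOn f Q.toSet) :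
    Q.avgAbs f ≤ Q.osc f + |Q.avg f| := by
  have hi := Q.integrable_unif hf
  have h1 : Q.avgAbs f ≤ ∫ x, (|f x - Q.avg f| + |Q.avg f|) ∂Q.unif := by
    refine integral_mono hi.abs
      ((Q.integrable_unif_abs_sub_const hf _).add (integrable_const _)) fun x => ?_
    simpa using abs_add_le (f x - Q.avg f) (Q.avg f)
  rw [integral_add (Q.integrable_unif_abs_sub_const hf _) (integrable_const _)] at h1
  simp only [integral_const, probReal_univ, one_smul] at h1
  exact h1

lemma osc_sub_le (Q : Cube n) {f g : (Fin n → ℝ) → ℝ} (hf : IntegrableOn f Q.toSet)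
    (hg : IntegrableOn g Q.toSet) : Q.osc (f - g) ≤ Q.osc f + Q.osc g := by
  have hi := Q.integrable_unif hf
  have hj := Q.integrable_unif hg
  rw [osc_eq, osc_eq, osc_eq, ← integral_add (Q.integrable_unif_abs_sub_const hf _)
    (Q.integrable_unif_abs_sub_const hg _)]
  have e : Q.avg (f - g) = Q.avg f - Q.avg g := integral_sub hi hj
  refine integral_mono (((hi.sub hj).sub (integrable_const _)).abs)
    ((Q.integrable_unif_abs_sub_const hf _).add (Q.integrable_unif_abs_sub_const hg _)) fun x => ?_
  simp only [Pi.sub_apply, e]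
  rw [show f x - g x - (Q.avg f - Q.avg g) = (f x - Q.avg f) - (g x - Q.avg g) by ring]
  exact abs_sub _ _

lemma avgAbs_sub_le (Q : Cube n) {f g : (Fin n → ℝ) → ℝ} (hf : IntegrableOn f Q.toSet)
    (hg : IntegrableOn g Q.toSet) : Q.avgAbs (f - g) ≤ Q.avgAbs f + Q.avgAbs g := by
  have hi := Q.integrable_unif hf
  have hj := Q.integrable_unif hg
  rw [avgAbs_eq, avgAbs_eq, avgAbs_eq, ← integral_add hi.abs hj.abs]
  exact integral_mono (hi.sub hj).abs (hi.abs.add hj.abs) fun x => abs_sub _ _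

lemma integral_unif_le_of_subset {P Q : Cube n} (h : P.toSet ⊆ Q.toSet)
    {F : (Fin n → ℝ) → ℝ} (hF : IntegrableOn F Q.toSet) (h0 : ∀ x, 0 ≤ F x) :
    ∫ x, F x ∂P.unif ≤ (Q.half / P.half) ^ n * ∫ x, F x ∂Q.unif := by
  have hP := P.half_pos
  have hQ := Q.half_pos
  have h1 : ∫ x in P.toSet, F x ≤ ∫ x in Q.toSet, F x :=
    setIntegral_mono_set hF (Eventually.of_forall h0) h.eventuallyLE
  rw [integral_unif, integral_unif, ← mul_assoc]
  have h2 : (Q.half / P.half) ^ n * ((2 * Q.half) ^ n)⁻¹ = ((2 * P.half) ^ n)⁻¹ := by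
    rw [← inv_pow, ← inv_pow, ← mul_pow]
    congr 1
    field_simp
  rw [h2]
  gcongr

lemma abs_avg_sub_avg_le {P Q : Cube n} (h : P.toSet ⊆ Q.toSet)
    {f : (Fin n → ℝ) → ℝ} (hf : IntegrableOn f Q.toSet) :
    |P.avg f - Q.avg f| ≤ (Q.half / P.half) ^ n * Q.osc f :=
  (P.abs_avg_sub_le (hf.mono_set h) _).trans
    (integral_unif_le_of_subset h (hf.sub (Q.integrableOn_const _)).abs fun _ => abs_nonneg _)

end Cube

lemma distBd_le_add (U : Set (Fin n → ℝ)) (x y : Fin n → ℝ) :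
    distBd U x ≤ distBd U y + dist x y := infDist_le_infDist_add_dist

lemma distBd_nonneg (U : Set (Fin n → ℝ)) (x : Fin n → ℝ) : 0 ≤ distBd U x := infDist_nonneg

lemma continuous_distBd (U : Set (Fin n → ℝ)) : Continuous (distBd U) := continuous_infDist_pt _

lemma closedBall_subset_of_lt_distBd {U : Set (Fin n → ℝ)} (hU : IsOpen U) {x : Fin n → ℝ}
    (hx : x ∈ U) {r : ℝ} (h : r < distBd U x) : closedBall x r ⊆ U := by
  by_cases hr : 0 ≤ r
  · have hdisj : Disjoint (closedBall x r) (frontier U) := by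
      rw [Set.disjoint_left]
      intro y hy hyU
      have := infDist_le_dist_of_mem (x := x) hyU
      rw [mem_closedBall, dist_comm] at hy
      exact absurd h (not_lt.2 (this.trans hy))
    have hpre : IsPreconnected (closedBall x r) := (convex_closedBall x r).isPreconnected
    refine hpre.subset_left_of_subset_union hU isClosed_closure.isOpen_compl
      (Set.disjoint_left.2 fun y hy hy' => hy' (subset_closure hy)) ?_
      ⟨x, mem_closedBall_self hr, hx⟩
    intro y hy
    by_cases hyU : y ∈ closure U
    · refine Or.inl ?_
      by_contra hn
      exact Set.disjoint_left.1 hdisj hy (by rw [hU.frontier_eq]; exact ⟨hyU, hn⟩)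
    · exact Or.inr hyU
  · rw [closedBall_eq_empty.2 (not_le.1 hr)]
    exact Set.empty_subset _

lemma Cube.half_le_distBd_center {U : Set (Fin n → ℝ)} (hU : IsOpen U)
    (hne : (frontier U).Nonempty) {Q : Cube n} (h : Q.toSet ⊆ U) : Q.half ≤ distBd U Q.center := by
  refine (le_infDist hne).2 fun y hy => ?_
  by_contra hlt
  rw [hU.frontier_eq] at hy
  refine hy.2 (h ?_)
  rw [Cube.toSet, mem_closedBall, dist_comm]
  exact (not_le.1 hlt).le

lemma distBd_pos {U : Set (Fin n → ℝ)} (hU : IsOpen U) (hne : (frontier U).Nonempty)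
    {x : Fin n → ℝ} (hx : x ∈ U) : 0 < distBd U x := by
  refine (isClosed_frontier.notMem_iff_infDist_pos hne).1 fun h => ?_
  rw [hU.frontier_eq] at h
  exact h.2 hx

lemma IsEpsDeltaDomain.exists_midpoint {U : Set (Fin n → ℝ)} {ε δ : ℝ} (hε : 0 < ε)
    (hed : IsEpsDeltaDomain U ε δ) {x y : Fin n → ℝ} (hx : x ∈ U) (hy : y ∈ U)
    (h0 : 0 < dist x y) (h1 : dist x y < δ) :
    ∃ z ∈ U, dist z x = dist x y / 2 ∧ ε * dist x y / 4 ≤ distBd U z := by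
  obtain ⟨γ, hc, g0, g1, hmem, -, hbd⟩ := hed x hx y hy h1
  have hcont : ContinuousOn (fun t => dist (γ t) x) (Set.Icc 0 1) :=
    (continuous_id.dist continuous_const).comp_continuousOn hc
  have hiv := intermediate_value_Icc zero_le_one hcont
  have hm : dist x y / 2 ∈ Set.Icc (dist (γ 0) x) (dist (γ 1) x) := by
    rw [g0, g1, dist_self, dist_comm y x]
    exact ⟨by linarith, by linarith⟩
  obtain ⟨t, ht, hteq⟩ := hiv hm
  simp only at hteq
  refine ⟨γ t, hmem t ht, hteq, le_trans ?_ (hbd t ht)⟩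
  have h2 : dist x y / 2 ≤ dist (γ t) y := by
    have := dist_triangle_left x y (γ t)
    linarith
  rw [le_div_iff₀ h0, hteq]
  have : 0 ≤ ε * (dist x y / 2) * (dist (γ t) y - dist x y / 2) := by
    have := sub_nonneg.2 h2
    positivity
  nlinarith

lemma IsPreconnected.exists_dist_eq {U : Set (Fin n → ℝ)} (hU : IsPreconnected U)
    {x y : Fin n → ℝ} (hx : x ∈ U) (hy : y ∈ U) {r : ℝ} (h0 : 0 ≤ r) (hr : r ≤ dist x y) :
    ∃ z ∈ U, dist x z = r := by
  have := hU.intermediate_value hx hy (f := fun z => dist x z) (by fun_prop)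
  obtain ⟨z, hz, e⟩ := this (show r ∈ Set.Icc (dist x x) (dist x y) by simp [h0, hr])
  exact ⟨z, hz, e⟩

lemma exists_ne_mem_dist_lt {U : Set (Fin n → ℝ)} (hn : 0 < n) (hU : IsOpen U)
    {x : Fin n → ℝ} (hx : x ∈ U) {r : ℝ} (hr : 0 < r) : ∃ y ∈ U, 0 < dist x y ∧ dist x y < r := by
  obtain ⟨s, hs, hsU⟩ := Metric.isOpen_iff.1 hU x hx
  have : NeZero n := ⟨hn.ne'⟩
  have hm : 0 < min r s / 2 := by positivity
  obtain ⟨v, hv⟩ := exists_norm_eq (Fin n → ℝ) hm.le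
  have hd : dist x (x + v) = min r s / 2 := by simp [hv]
  have h1 := min_le_left r s
  have h2 := min_le_right r s
  refine ⟨x + v, hsU ?_, ?_, ?_⟩
  · rw [mem_ball, dist_comm, hd]; linarith
  · rw [hd]; exact hm
  · rw [hd]; linarith

lemma IsEpsDeltaDomain.frontier_nonempty {U : Set (Fin n → ℝ)} {ε δ : ℝ} (hn : 0 < n)
    (hε : 0 < ε) (hδ : 0 < δ) (hU : IsRealDomain U) (hed : IsEpsDeltaDomain U ε δ) :
    (frontier U).Nonempty := by
  obtain ⟨x, hx⟩ := hU.2.nonempty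
  obtain ⟨y, hy, h0, h1⟩ := exists_ne_mem_dist_lt hn hU.1 hx hδ
  obtain ⟨z, -, -, hz⟩ := hed.exists_midpoint hε hx hy h0 h1
  by_contra he
  rw [Set.not_nonempty_iff_eq_empty] at he
  rw [distBd, he, infDist_empty] at hz
  have : 0 < ε * dist x y / 4 := by positivity
  linarith

/-- If a function changes by at most `K` between points of a curve at distance at most `ρ`, then it
changes by at most `(N + 1) * K` along a curve of length at most `N * ρ`. -/
lemma abs_sub_le_of_eVariationOn_le {E : Type*} [PseudoMetricSpace E] {γ : ℝ → E} {u : E → ℝ}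
    {ρ K : ℝ} (hρ : 0 ≤ ρ) (hK : 0 ≤ K) {b : ℝ} (N : ℕ) {a : ℝ} (hab : a ≤ b)
    (hc : ContinuousOn γ (Set.Icc a b))
    (hu : ∀ s ∈ Set.Icc a b, ∀ t ∈ Set.Icc a b, dist (γ s) (γ t) ≤ ρ →
      |u (γ s) - u (γ t)| ≤ K)
    (hv : eVariationOn γ (Set.Icc a b) ≤ ENNReal.ofReal (N * ρ)) :
    |u (γ a) - u (γ b)| ≤ (N + 1) * K := by
  induction N generalizing a with
  | zero =>
    have ha : a ∈ Set.Icc a b := ⟨le_rfl, hab⟩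
    have hb : b ∈ Set.Icc a b := ⟨hab, le_rfl⟩
    have h := (eVariationOn.edist_le γ ha hb).trans hv
    rw [edist_dist, ENNReal.ofReal_le_ofReal_iff (by simp)] at h
    have := hu a ha b hb (by push_cast at h; linarith)
    simpa using this
  | succ N ih =>
    have ha : a ∈ Set.Icc a b := ⟨le_rfl, hab⟩
    have hb : b ∈ Set.Icc a b := ⟨hab, le_rfl⟩
    by_cases hd : dist (γ a) (γ b) ≤ ρ
    · refine (hu a ha b hb hd).trans (le_mul_of_one_le_left hK ?_)
      have : (0 : ℝ) ≤ (N + 1 : ℕ) := Nat.cast_nonneg _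
      linarith
    · have hiv := intermediate_value_Icc hab
        (f := fun t => dist (γ a) (γ t)) ((continuous_const.dist continuous_id).comp_continuousOn hc)
      obtain ⟨t, ht, hteq⟩ := hiv (show ρ ∈ Set.Icc _ _ from
        ⟨by simpa using hρ, (not_le.1 hd).le⟩)
      simp only at hteq
      have hsplit := eVariationOn.Icc_add_Icc γ (s := Set.univ) ht.1 ht.2 (Set.mem_univ t)
      simp only [Set.univ_inter] at hsplit
      have h1 : ENNReal.ofReal ρ ≤ eVariationOn γ (Set.Icc a t) := by
        rw [← hteq, ← edist_dist]
        exact eVariationOn.edist_le γ ⟨le_rfl, ht.1⟩ ⟨ht.1, le_rfl⟩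
      have h2 : eVariationOn γ (Set.Icc t b) ≤ ENNReal.ofReal (N * ρ) := by
        have h3 : ENNReal.ofReal ρ + eVariationOn γ (Set.Icc t b) ≤
            ENNReal.ofReal ρ + ENNReal.ofReal (N * ρ) := by
          rw [← ENNReal.ofReal_add hρ (by positivity)]
          refine (add_le_add_left h1 _).trans ?_
          rw [hsplit, show ρ + N * ρ = (N + 1 : ℕ) * ρ by push_cast; ring]
          exact hv
        exact (ENNReal.add_le_add_iff_left ENNReal.ofReal_ne_top).1 h3
      have hsub : Set.Icc t b ⊆ Set.Icc a b := Set.Icc_subset_Icc_left ht.1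
      have h4 := ih ht.2 (hc.mono hsub) (fun s hs t ht => hu s (hsub hs) t (hsub ht)) h2
      have h5 := hu a ha t ht hteq.le
      have h6 := abs_sub_le (u (γ a)) (u (γ t)) (u (γ b))
      push_cast
      linarith

/-- The mean of `f` over the sup-norm ball of centre `z` and radius `h`. -/
def ballAvg (f : (Fin n → ℝ) → ℝ) (z : Fin n → ℝ) (h : ℝ) : ℝ := ⨍ x in closedBall z h, f x

/-- The weight `1 + log (1 + 1 / h)`. -/
def logWeight (h : ℝ) : ℝ := 1 + Real.log (1 + h⁻¹)

/-- `f` is integrable on every cube in `U`, with mean oscillation at most `C`. -/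
def OscBound (U : Set (Fin n → ℝ)) (f : (Fin n → ℝ) → ℝ) (C : ℝ) : Prop :=
  ∀ Q : Cube n, Q.toSet ⊆ U → IntegrableOn f Q.toSet ∧ Q.osc f ≤ C

namespace OscBound

variable {U : Set (Fin n → ℝ)} {f : (Fin n → ℝ) → ℝ} {C : ℝ}

lemma abs_avg_sub_avg_le (hf : OscBound U f C) {P Q : Cube n} (h : P.toSet ⊆ Q.toSet)
    (hQ : Q.toSet ⊆ U) : |P.avg f - Q.avg f| ≤ (Q.half / P.half) ^ n * C := by
  have h1 := P.half_pos
  have h2 := Q.half_pos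
  refine (Cube.abs_avg_sub_avg_le h (hf Q hQ).1).trans ?_
  gcongr
  exact (hf Q hQ).2

lemma abs_ballAvg_sub_scale_le (hf : OscBound U f C) {z : Fin n → ℝ} {h k : ℝ} (hh : 0 < h)
    (hhk : h ≤ k) (hk : closedBall z k ⊆ U) :
    |ballAvg f z h - ballAvg f z k| ≤ (k / h) ^ n * C :=
  hf.abs_avg_sub_avg_le (P := ⟨z, h, hh⟩) (Q := ⟨z, k, hh.trans_le hhk⟩)
    (closedBall_subset_closedBall hhk) hk

lemma abs_ballAvg_sub_near_le (hf : OscBound U f C) {z w : Fin n → ℝ} {h : ℝ} (hh : 0 < h)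
    (hzw : dist z w ≤ h) (hk : closedBall z (2 * h) ⊆ U) :
    |ballAvg f z h - ballAvg f w h| ≤ 2 * (2 ^ n * C) := by
  have h1 := hf.abs_avg_sub_avg_le (P := ⟨z, h, hh⟩) (Q := ⟨z, 2 * h, by positivity⟩)
    (closedBall_subset_closedBall (by linarith)) hk
  have h2 := hf.abs_avg_sub_avg_le (P := ⟨w, h, hh⟩) (Q := ⟨z, 2 * h, by positivity⟩)
    (closedBall_subset_closedBall' (by rw [dist_comm]; linarith)) hk
  have e : 2 * h / h = 2 := by field_simp
  simp only [e] at h1 h2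
  rw [abs_sub_comm] at h2
  have h3 := abs_sub_le (ballAvg f z h) (ballAvg f z (2 * h)) (ballAvg f w h)
  have h4 : |ballAvg f z h - ballAvg f z (2 * h)| ≤ 2 ^ n * C := h1
  have h5 : |ballAvg f z (2 * h) - ballAvg f w h| ≤ 2 ^ n * C := h2
  linarith

/-- Means at two points far from the boundary are comparable, by a chain of cubes along a curve. -/
lemma abs_ballAvg_sub_le (hU : IsOpen U) {ε δ : ℝ} (hε : 0 < ε) (hε1 : ε ≤ 1)
    (hed : IsEpsDeltaDomain U ε δ) (hC : 0 ≤ C) (hf : OscBound U f C) {a b : Fin n → ℝ}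
    (ha : a ∈ U) (hb : b ∈ U) (hab : dist a b < δ) {c L : ℝ} (hc : 0 < c) (hca : c ≤ distBd U a)
    (hcb : c ≤ distBd U b) (hL : dist a b ≤ L) :
    |ballAvg f a (ε * c / 10) - ballAvg f b (ε * c / 10)| ≤
      (⌈10 * (L / c) / ε ^ 2⌉₊ + 1) * (2 * (2 ^ n * C)) := by
  rcases eq_or_ne a b with rfl | hne
  · rw [sub_self, abs_zero]
    positivity
  have hpos : 0 < dist a b := dist_pos.2 hne
  obtain ⟨γ, hγ, g0, g1, hmem, hvar, hbd⟩ := hed a ha b hb hab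
  have hd : ∀ t ∈ Set.Icc (0 : ℝ) 1, ε * c / 4 ≤ distBd U (γ t) := by
    intro t ht
    have h1 := hbd t ht
    have h2 := distBd_le_add U a (γ t)
    have h3 := distBd_le_add U b (γ t)
    rw [dist_comm] at h2 h3
    have h4 := dist_triangle_left a b (γ t)
    by_contra! hlt
    have hec : ε * c ≤ c := by nlinarith
    have h5 : c / 2 < dist (γ t) a := by linarith
    have h6 : c / 2 < dist (γ t) b := by linarith
    rw [div_le_iff₀ hpos] at h1
    have h7 : infDist (γ t) (frontier U) * dist a b < ε * c / 4 * dist a b :=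
      mul_lt_mul_of_pos_right hlt hpos
    rcases le_total (dist (γ t) a) (dist (γ t) b) with h | h
    · have h8 : dist a b / 2 ≤ dist (γ t) b := by linarith
      have h9 : c / 2 * (dist a b / 2) ≤ dist (γ t) a * dist (γ t) b := by gcongr
      nlinarith [mul_le_mul_of_nonneg_left h9 hε.le]
    · have h8 : dist a b / 2 ≤ dist (γ t) a := by linarith
      have h9 : dist a b / 2 * (c / 2) ≤ dist (γ t) a * dist (γ t) b := by gcongr
      nlinarith [mul_le_mul_of_nonneg_left h9 hε.le]
  have hh : 0 < ε * c / 10 := by positivity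
  have key := abs_sub_le_of_eVariationOn_le (γ := γ) (u := fun z => ballAvg f z (ε * c / 10))
    (ρ := ε * c / 10) (K := 2 * (2 ^ n * C)) hh.le (by positivity)
    ⌈10 * (L / c) / ε ^ 2⌉₊ zero_le_one hγ ?_ ?_
  · simpa only [g0, g1] using key
  · intro s hs t _ hst
    refine hf.abs_ballAvg_sub_near_le hh hst ?_
    exact closedBall_subset_of_lt_distBd hU (hmem s hs) (lt_of_lt_of_le (by linarith) (hd s hs))
  · refine hvar.trans (ENNReal.ofReal_le_ofReal ?_)
    calc ε⁻¹ * dist a b ≤ ε⁻¹ * L := by gcongr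
      _ = 10 * (L / c) / ε ^ 2 * (ε * c / 10) := by field_simp
      _ ≤ _ := by
        gcongr
        exact Nat.le_ceil _


/-- Means over cubes comparable to their distance to a point `x` grow at most linearly in the number
of dyadic steps from the scale `r` to the point. -/
lemma abs_ballAvg_le_of_dyadic (hU : IsOpen U) {ε δ : ℝ} (hε : 0 < ε) (hε1 : ε ≤ 1)
    (hed : IsEpsDeltaDomain U ε δ) (hC : 0 ≤ C) (hf : OscBound U f C) {r M : ℝ} (hr : 0 < r)
    (hrδ : r < δ) (hpre : IsPreconnected U) (hfar : ∀ x ∈ U, ∃ y ∈ U, r ≤ dist x y)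
    (hbase : ∀ z ∈ U, ε * r / 4 ≤ distBd U z → |ballAvg f z (ε ^ 2 * r / 80)| ≤ M) :
    ∃ K, 0 ≤ K ∧ ∀ k : ℕ, ∀ x ∈ U, ∃ z ∈ U, dist z x = r / 2 ^ k / 2 ∧
      |ballAvg f z (ε ^ 2 * (r / 2 ^ k) / 80)| ≤ M + K * k := by
  have hmid : ∀ k : ℕ, ∀ x ∈ U, ∃ z ∈ U, dist z x = r / 2 ^ k / 2 ∧
      ε * (r / 2 ^ k) / 4 ≤ distBd U z := by
    intro k x hx
    have hk0 : 0 < r / 2 ^ k := by positivity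
    have hk1 : r / 2 ^ k ≤ r := div_le_self hr.le (one_le_pow₀ one_le_two)
    obtain ⟨y, hy, hxy⟩ := hfar x hx
    obtain ⟨w, hw, hxw⟩ := hpre.exists_dist_eq hx hy hk0.le (hk1.trans hxy)
    obtain ⟨z, hz, h1, h2⟩ := hed.exists_midpoint hε hx hw (hxw ▸ hk0) (hxw ▸ by linarith)
    exact ⟨z, hz, hxw ▸ h1, hxw ▸ h2⟩
  set K := (⌈10 * (6 / ε) / ε ^ 2⌉₊ + 1) * (2 * (2 ^ n * C)) + 2 ^ n * C with hK
  have main : ∀ k : ℕ, ∀ x ∈ U, ∀ z ∈ U, dist z x = r / 2 ^ k / 2 →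
      ε * (r / 2 ^ k) / 4 ≤ distBd U z →
      |ballAvg f z (ε ^ 2 * (r / 2 ^ k) / 80)| ≤ M + K * k := by
    intro k
    induction k with
    | zero =>
      intro x _ z hz _ h
      simpa using hbase z hz (by simpa using h)
    | succ k ih =>
      intro x hx z hz hzx hzd
      obtain ⟨w, hw, hwx, hwd⟩ := hmid k x hx
      have h0 := ih x hx w hw hwx hwd
      have hk1 : r / 2 ^ k ≤ r := div_le_self hr.le (one_le_pow₀ one_le_two)
      have hs : r / 2 ^ (k + 1) = r / 2 ^ k / 2 := by rw [pow_succ]; field_simp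
      rw [hs] at hzx hzd ⊢
      have hs0 : 0 < r / 2 ^ k := by positivity
      set s := r / 2 ^ k
      have hzw : dist w z ≤ 3 * s / 4 := by
        have := dist_triangle_right w z x
        linarith
      have hεs : 0 < ε * s := by positivity
      have hεs' : ε ^ 2 * s ≤ ε * s := by
        rw [sq, mul_assoc]
        exact mul_le_of_le_one_left hεs.le hε1
      have h1 := abs_ballAvg_sub_le hU hε hε1 hed hC hf hw hz (by linarith)
        (c := ε * s / 8) (by positivity) (by linarith) (by linarith) hzw
      rw [show ε * (ε * s / 8) / 10 = ε ^ 2 * s / 80 by ring,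
        show 3 * s / 4 / (ε * s / 8) = 6 / ε by field_simp; norm_num] at h1
      have h2 := hf.abs_ballAvg_sub_scale_le (z := z) (h := ε ^ 2 * (s / 2) / 80)
        (k := ε ^ 2 * s / 80) (by positivity) (by linarith [mul_pos (pow_pos hε 2) hs0])
        (closedBall_subset_of_lt_distBd hU hz (by linarith))
      rw [show ε ^ 2 * s / 80 / (ε ^ 2 * (s / 2) / 80) = 2 by field_simp] at h2
      have h3 := abs_le.1 h0
      have h4 := abs_le.1 h1
      have h5 := abs_le.1 h2
      push_cast
      rw [abs_le]
      constructor <;> linarith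
  refine ⟨K, by positivity, fun k x hx => ?_⟩
  obtain ⟨z, hz, h1, h2⟩ := hmid k x hx
  exact ⟨z, hz, h1, main k x hx z hz h1 h2⟩

end OscBound

lemma lamED_pos {ε δ : ℝ} (hn : 0 < n) (hε : 0 < ε) (hδ : 0 < δ) : 0 < lamED n ε δ := by
  have : (0 : ℝ) < n := Nat.cast_pos.2 hn
  unfold lamED
  positivity

lemma lamED_le {ε δ : ℝ} (hn : 0 < n) (hε : 0 < ε) (hδ : 0 < δ) :
    lamED n ε δ ≤ ε ^ 2 * δ / 80 := by
  have : (1 : ℝ) ≤ n := Nat.one_le_cast.2 hn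
  unfold lamED
  gcongr
  have h1 : 0 ≤ √n * ε := by positivity
  nlinarith

/-- On an (ε,δ)-domain there is a scale at which all means of a bmo function are bounded. -/
lemma OscBound.exists_scale {U : Set (Fin n → ℝ)} {f : (Fin n → ℝ) → ℝ} {C : ℝ} (hn : 0 < n)
    (hU : IsRealDomain U) {ε δ : ℝ} (hε : 0 < ε) (hε1 : ε ≤ 1) (hδ : 0 < δ)
    (hed : IsEpsDeltaDomain U ε δ) (hC : 0 ≤ C) (hf : OscBound U f C)
    (hbig : ∀ Q : Cube n, Q.toSet ⊆ U → lamED n ε δ ≤ Q.side → Q.avgAbs f ≤ C) :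
    ∃ r M : ℝ, 0 < r ∧ r < δ ∧ 0 ≤ M ∧ (∀ x ∈ U, ∃ y ∈ U, r ≤ dist x y) ∧
      ∀ z ∈ U, ε * r / 4 ≤ distBd U z → |ballAvg f z (ε ^ 2 * r / 80)| ≤ M := by
  have hε2 : ε ^ 2 ≤ ε := by nlinarith
  by_cases hA : ∀ x ∈ U, ∃ y ∈ U, δ / 2 ≤ dist x y
  · refine ⟨δ / 2, C, by positivity, by linarith, hC, hA, fun z hz hd => ?_⟩
    have hsub : closedBall z (ε ^ 2 * (δ / 2) / 80) ⊆ U :=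
      closedBall_subset_of_lt_distBd hU.1 hz
        (by linarith [mul_le_mul_of_nonneg_right hε2 hδ.le, mul_pos hε hδ])
    let Q : Cube n := ⟨z, ε ^ 2 * (δ / 2) / 80, by positivity⟩
    have hside : Q.side = ε ^ 2 * δ / 80 := by
      change 2 * (ε ^ 2 * (δ / 2) / 80) = _
      ring
    exact (Q.abs_avg_le f).trans (hbig Q hsub (hside ▸ lamED_le hn hε hδ))
  · push Not at hA
    obtain ⟨a, ha, hbd⟩ := hA
    have hne := hed.frontier_nonempty hn hε hδ hU
    obtain ⟨b, hb, hab0, hab1⟩ := exists_ne_mem_dist_lt hn hU.1 ha hδ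
    have hab2 := hbd b hb
    have hda := distBd_pos hU.1 hne ha
    set r := dist a b / 2 with hr
    have hr0 : 0 < r := by positivity
    set c := min (distBd U a) (ε * r / 8) with hcdef
    have hc : 0 < c := by positivity
    have hc1 : c ≤ distBd U a := min_le_left _ _
    have hc2 : c ≤ ε * r / 8 := min_le_right _ _
    set h := ε * c / 10
    have hh : 0 < h := by positivity
    have hhk : h ≤ ε ^ 2 * r / 80 := by
      have := mul_le_mul_of_nonneg_left hc2 hε.le
      simp only [h]
      linarith
    refine ⟨r, |ballAvg f a h| + (⌈10 * (δ / c) / ε ^ 2⌉₊ + 1) * (2 * (2 ^ n * C)) +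
      (ε ^ 2 * r / 80 / h) ^ n * C, hr0, by linarith, by positivity, fun x hx => ?_,
      fun z hz hd => ?_⟩
    · by_contra! hcon
      have h1 := hcon a ha
      have h2 := hcon b hb
      have h3 := dist_triangle_left a b x
      linarith
    · have haz := hbd z hz
      have h1 := hf.abs_ballAvg_sub_le hU.1 hε hε1 hed hC ha hz (by linarith) hc hc1
        (by linarith [mul_pos hε hr0]) (L := δ) (by linarith)
      have h2 := hf.abs_ballAvg_sub_scale_le (z := z) hh hhk
        (closedBall_subset_of_lt_distBd hU.1 hz
          (by linarith [mul_le_mul_of_nonneg_right hε2 hr0.le, mul_pos hε hr0]))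
      have h3 := abs_le.1 h1
      have h4 := abs_le.1 h2
      have h5 := abs_le.1 (le_refl |ballAvg f a h|)
      rw [abs_le]
      constructor <;> linarith

lemma one_le_logWeight {h : ℝ} (hh : 0 ≤ h) : 1 ≤ logWeight h := by
  have : 0 ≤ h⁻¹ := inv_nonneg.2 hh
  have := Real.log_nonneg (show 1 ≤ 1 + h⁻¹ by linarith)
  rw [logWeight]
  linarith

lemma logWeight_anti {p q : ℝ} (hp : 0 < p) (hpq : p ≤ q) : logWeight q ≤ logWeight p := by
  unfold logWeight
  have := hp.trans_le hpq
  gcongr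

lemma logWeight_le_add {p q : ℝ} (hp : 0 < p) (hpq : p ≤ q) :
    logWeight p ≤ logWeight q + Real.log (q / p) := by
  have hq := hp.trans_le hpq
  have h1 : 1 + p⁻¹ ≤ (1 + q⁻¹) * (q / p) := by
    have : (1 + q⁻¹) * (q / p) = q / p + p⁻¹ := by field_simp
    rw [this]
    gcongr
    rwa [one_le_div hp]
  have h2 := Real.log_le_log (by positivity) h1
  rw [Real.log_mul (by positivity) (by positivity)] at h2
  unfold logWeight
  linarith

lemma mul_logWeight_le {h : ℝ} (hh : 0 < h) : h * logWeight h ≤ h + 1 := by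
  have h1 := Real.log_le_sub_one_of_pos (show 0 < 1 + h⁻¹ by positivity)
  have h2 : h * Real.log (1 + h⁻¹) ≤ h * h⁻¹ := by gcongr; linarith
  rw [mul_inv_cancel₀ hh.ne'] at h2
  unfold logWeight
  linarith

/-- On an (ε,δ)-domain the mean of a bmo function over a cube grows at most logarithmically as the
cube shrinks. -/
theorem OscBound.exists_avgAbs_le_logWeight {U : Set (Fin n → ℝ)} {f : (Fin n → ℝ) → ℝ} {C : ℝ}
    (hn : 0 < n) (hU : IsRealDomain U) {ε δ : ℝ} (hε : 0 < ε) (hε1 : ε ≤ 1) (hδ : 0 < δ)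
    (hed : IsEpsDeltaDomain U ε δ) (hC : 0 ≤ C) (hf : OscBound U f C)
    (hbig : ∀ Q : Cube n, Q.toSet ⊆ U → lamED n ε δ ≤ Q.side → Q.avgAbs f ≤ C) :
    ∃ C₀, 0 ≤ C₀ ∧ ∀ Q : Cube n, Q.toSet ⊆ U → Q.avgAbs f ≤ C₀ * logWeight Q.half := by
  obtain ⟨r, M, hr, hrδ, hM, hfar, hbase⟩ := hf.exists_scale hn hU hε hε1 hδ hed hC hbig
  obtain ⟨K, hK, hdy⟩ := abs_ballAvg_le_of_dyadic hU.1 hε hε1 hed hC hf hr hrδ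
    hU.2.isPreconnected hfar hbase
  have hlam := lamED_pos hn hε hδ
  set lam := lamED n ε δ
  set D := 80 * lam / (ε ^ 2 * r) + 160 / ε ^ 2 with hD
  have hlog0 : 0 ≤ Real.log (1 + 2 * r) := Real.log_nonneg (by linarith)
  refine ⟨C + (M + K * (2 * (Real.log (1 + 2 * r) + 1)) + D ^ n * C), by positivity,
    fun Q hQ => ?_⟩
  have hh := Q.half_pos
  set h := Q.half with hhdef
  have hg := one_le_logWeight hh.le
  by_cases hside : lam ≤ Q.side
  · refine (hbig Q hQ hside).trans ((le_add_of_nonneg_right (by positivity)).trans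
      (le_mul_of_one_le_right (by positivity) hg))
  have hhlam : h < lam := by
    have : ¬ lam ≤ 2 * h := hside
    linarith
  have hex : ∃ k : ℕ, r / 2 ^ k ≤ h := by
    obtain ⟨k, hk⟩ := pow_unbounded_of_one_lt (r / h) one_lt_two
    refine ⟨k, ?_⟩
    rw [div_lt_iff₀ hh] at hk
    rw [div_le_iff₀ (by positivity)]
    linarith
  classical
  obtain ⟨k, hk, hkmin⟩ : ∃ k : ℕ, r / 2 ^ k ≤ h ∧ ∀ m < k, h < r / 2 ^ m :=
    ⟨Nat.find hex, Nat.find_spec hex, fun m hm => not_le.1 (Nat.find_min hex hm)⟩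
  have hk0 : 0 < r / 2 ^ k := by positivity
  have hprev : k = 0 ∨ h < 2 * (r / 2 ^ k) := by
    rcases k with _ | k
    · exact Or.inl rfl
    · right
      have := hkmin k (Nat.lt_succ_self k)
      rw [pow_succ]
      field_simp at this ⊢
      linarith
  have hkD : h / (ε ^ 2 * (r / 2 ^ k) / 80) ≤ D := by
    rcases hprev with h0 | h1
    · subst h0
      calc h / (ε ^ 2 * (r / 2 ^ 0) / 80) ≤ lam / (ε ^ 2 * (r / 2 ^ 0) / 80) := by gcongr
        _ = 80 * lam / (ε ^ 2 * r) := by simp; field_simp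
        _ ≤ D := by simp only [hD]; exact le_add_of_nonneg_right (by positivity)
    · calc h / (ε ^ 2 * (r / 2 ^ k) / 80) ≤ 2 * (r / 2 ^ k) / (ε ^ 2 * (r / 2 ^ k) / 80) := by
            gcongr
        _ = 160 / ε ^ 2 := by field_simp; norm_num
        _ ≤ D := by simp only [hD]; exact le_add_of_nonneg_left (by positivity)
  have hkg : (k : ℝ) ≤ 2 * (Real.log (1 + 2 * r) + 1) * logWeight h := by
    have h2k : (2 : ℝ) ^ k ≤ (1 + 2 * r) * (1 + h⁻¹) := by
      have hinv : 0 < h⁻¹ := inv_pos.2 hh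
      rcases hprev with h0 | h1
      · subst h0
        have := mul_pos hr hinv
        simp only [pow_zero]
        nlinarith
      · have h3 : h * 2 ^ k < 2 * r := by
          rw [← mul_div_assoc, lt_div_iff₀ (by positivity)] at h1
          exact h1
        have h4 : (2 : ℝ) ^ k ≤ 2 * r * h⁻¹ := by
          rw [← div_eq_mul_inv, le_div_iff₀ hh]
          linarith
        nlinarith
    have hl := Real.log_le_log (by positivity) h2k
    rw [Real.log_pow, Real.log_mul (by positivity) (by positivity)] at hl
    have hl2 : 1 / 2 ≤ Real.log 2 := by
      have := Real.log_two_gt_d9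
      linarith
    have h5 : (k : ℝ) * (1 / 2) ≤ k * Real.log 2 := by gcongr
    have h6 : Real.log (1 + h⁻¹) = logWeight h - 1 := by unfold logWeight; ring
    rw [h6] at hl
    nlinarith
  obtain ⟨z, hz, hzx, hzb⟩ := hdy k Q.center (hQ Q.center_mem)
  have hε2 : ε ^ 2 ≤ 1 := pow_le_one₀ hε.le hε1
  let P : Cube n := ⟨z, ε ^ 2 * (r / 2 ^ k) / 80, by positivity⟩
  have hPQ : P.toSet ⊆ Q.toSet := by
    refine closedBall_subset_closedBall' ?_
    have : ε ^ 2 * (r / 2 ^ k) ≤ 1 * (r / 2 ^ k) := by gcongr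
    change ε ^ 2 * (r / 2 ^ k) / 80 + dist z Q.center ≤ h
    linarith
  have hPa : |P.avg f - Q.avg f| ≤ (h / (ε ^ 2 * (r / 2 ^ k) / 80)) ^ n * C :=
    hf.abs_avg_sub_avg_le hPQ hQ
  have hPa' : |P.avg f - Q.avg f| ≤ D ^ n * C := hPa.trans (by gcongr)
  have hzb' : |P.avg f| ≤ M + K * k := hzb
  have h1 := Q.avgAbs_le_osc_add (hf Q hQ).1
  have h2 := (hf Q hQ).2
  have h3 : |Q.avg f| ≤ |P.avg f| + |P.avg f - Q.avg f| := by
    have := abs_sub_abs_le_abs_sub (Q.avg f) (P.avg f)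
    rw [abs_sub_comm] at this
    linarith
  have h4 : K * k ≤ K * (2 * (Real.log (1 + 2 * r) + 1) * logWeight h) := by gcongr
  calc Q.avgAbs f ≤ (C + (M + D ^ n * C)) +
        K * (2 * (Real.log (1 + 2 * r) + 1) * logWeight h) := by linarith
    _ ≤ (C + (M + D ^ n * C)) * logWeight h +
        K * (2 * (Real.log (1 + 2 * r) + 1) * logWeight h) := by
      gcongr
      exact le_mul_of_one_le_right (by positivity) hg
    _ = _ := by ring

lemma abs_log_logWeight_sub_le {p q a : ℝ} (hp : 0 < p) (hpq : p ≤ q) (ha : 0 < a)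
    (hq : q ≤ 2 * a) :
    |Real.log (logWeight p) - Real.log (logWeight q)| * logWeight a ≤ 2 * Real.log (q / p) := by
  have hq0 := hp.trans_le hpq
  have hgp := one_le_logWeight hp.le
  have hgq := one_le_logWeight hq0.le
  have hg2 := one_le_logWeight (show 0 ≤ 2 * a by positivity)
  have hga := one_le_logWeight ha.le
  have hanti := logWeight_anti hp hpq
  have hl : 0 ≤ Real.log (q / p) := Real.log_nonneg ((one_le_div hp).2 hpq)
  rw [abs_of_nonneg (sub_nonneg.2 (Real.log_le_log (by linarith) hanti)),
    ← Real.log_div (by linarith) (by linarith)]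
  have h1 : Real.log (logWeight p / logWeight q) ≤ Real.log (q / p) / logWeight q := by
    refine (Real.log_le_sub_one_of_pos (by positivity)).trans ?_
    rw [div_sub_one (by positivity)]
    gcongr
    linarith [logWeight_le_add hp hpq]
  have h2 : logWeight a ≤ 2 * logWeight q := by
    have h3 := logWeight_le_add ha (show a ≤ 2 * a by linarith)
    rw [show 2 * a / a = 2 by field_simp] at h3
    have h4 : Real.log 2 ≤ 1 := by linarith [Real.log_two_lt_d9]
    have h5 := logWeight_anti hq0 hq
    linarith
  calc Real.log (logWeight p / logWeight q) * logWeight a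
      ≤ Real.log (q / p) / logWeight q * (2 * logWeight q) := by
        gcongr
    _ = 2 * Real.log (q / p) := by field_simp

/-- The double logarithm varies little, relative to the weight of the scale `h`, on a range of
distances of size `h` around `a ≥ h`. -/
lemma abs_log_logWeight_sub_mul_le {a h p v : ℝ} (hh : 0 < h) (hha : h ≤ a) (hv : 0 < v)
    (hv1 : v ≤ 1) (hpa : |p - a| ≤ h * (1 - v)) :
    |Real.log (logWeight p) - Real.log (logWeight a)| * logWeight h ≤ 2 * (1 - Real.log v) := by
  have ha : 0 < a := hh.trans_le hha
  obtain ⟨hp1, hp2⟩ := abs_le.1 hpa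
  have hhv : 0 < h * v := by positivity
  have hp : 0 < p := by linarith
  set u := h / a with hu
  have hu0 : 0 < u := by positivity
  have hu1 : u ≤ 1 := (div_le_one ha).2 hha
  have hua : u * a = h := by rw [hu]; field_simp
  have hlv : Real.log v ≤ 0 := Real.log_nonpos hv.le hv1
  have key : |Real.log (logWeight p) - Real.log (logWeight a)| * logWeight a ≤
      2 * (u * (1 - Real.log v)) := by
    rcases le_total p a with hle | hle
    · refine (abs_log_logWeight_sub_le hp hle ha (by linarith)).trans ?_
      have h1 : u * Real.log v ≤ Real.log ((1 - u) * 1 + u * v) := by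
        have := strictConcaveOn_log_Ioi.concaveOn.2 (Set.mem_Ioi.2 one_pos) (Set.mem_Ioi.2 hv)
          (sub_nonneg.2 hu1) hu0.le (by ring)
        simpa using this
      have h2 : (1 - u) * 1 + u * v ≤ p / a := by
        rw [le_div_iff₀ ha]
        have : ((1 - u) * 1 + u * v) * a = a - u * a + (u * a) * v := by ring
        rw [this, hua]
        linarith
      have h3 := Real.log_le_log (by nlinarith) h2
      have h4 : Real.log (a / p) = -Real.log (p / a) := by rw [← Real.log_inv, inv_div]
      rw [h4]
      nlinarith
    · rw [abs_sub_comm]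
      refine (abs_log_logWeight_sub_le ha hle ha (by linarith)).trans ?_
      have h1 := Real.log_le_sub_one_of_pos (show 0 < p / a by positivity)
      have h2 : p / a ≤ 1 + u := by
        rw [div_le_iff₀ ha, add_mul, hua]
        linarith
      nlinarith
  have hga := one_le_logWeight ha.le
  have h5 : logWeight h ≤ logWeight a * u⁻¹ := by
    have h6 := logWeight_le_add hh hha
    have h7 := Real.log_le_sub_one_of_pos (show 0 < a / h by positivity)
    have h8 : a / h = u⁻¹ := by rw [hu, inv_div]
    rw [h8] at h6 h7
    have h9 : 1 ≤ u⁻¹ := (one_le_inv₀ hu0).2 hu1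
    nlinarith
  calc _ ≤ |Real.log (logWeight p) - Real.log (logWeight a)| * (logWeight a * u⁻¹) := by gcongr
    _ = |Real.log (logWeight p) - Real.log (logWeight a)| * logWeight a * u⁻¹ := by ring
    _ ≤ 2 * (u * (1 - Real.log v)) * u⁻¹ := by gcongr
    _ = 2 * (1 - Real.log v) := by field_simp

lemma integrable_indicator_neg_log_one_sub_norm (hn : 0 < n) :
    Integrable ((ball (0 : Fin n → ℝ) 1).indicator fun y => -Real.log (1 - ‖y‖)) := by
  have : NeZero n := ⟨hn.ne'⟩
  rw [integrable_indicator_iff measurableSet_ball]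
  have h1 : IntegrableOn (fun y : ℝ => -Real.log (1 - y)) (Set.Ioo 0 1) := by
    have := (intervalIntegral.intervalIntegrable_log' (a := 0) (b := 1)).comp_sub_left 1
    simp only [sub_zero, sub_self] at this
    rw [intervalIntegrable_iff, Set.uIoc_comm, Set.uIoc_of_le zero_le_one] at this
    exact (this.mono_set Set.Ioo_subset_Ioc_self).neg
  refine (integrableOn_fun_norm_addHaar (volume : Measure (Fin n → ℝ)) 
    (f := fun y => -Real.log (1 - y))).2 ?_
  refine Integrable.mono h1 ?_ ?_
  · have hm : Measurable fun y : ℝ =>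
        y ^ (Module.finrank ℝ (Fin n → ℝ) - 1) • -Real.log (1 - y) := by fun_prop
    exact hm.aestronglyMeasurable
  · filter_upwards [ae_restrict_mem measurableSet_Ioo] with y hy
    rw [norm_smul]
    refine mul_le_of_le_one_left (norm_nonneg _) ?_
    rw [norm_pow, Real.norm_of_nonneg hy.1.le]
    exact pow_le_one₀ hy.1.le hy.2.le

/-- The logarithm of the relative depth of a point in a cube has mean bounded independently of the
cube. -/
lemma Cube.exists_integral_neg_log_depth_le (hn : 0 < n) :
    ∃ B : ℝ, 0 ≤ B ∧ ∀ Q : Cube n,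
      IntegrableOn (fun x => -Real.log (1 - dist x Q.center / Q.half)) Q.toSet ∧
      ∫ x, -Real.log (1 - dist x Q.center / Q.half) ∂Q.unif ≤ B := by
  set G : (Fin n → ℝ) → ℝ := (ball (0 : Fin n → ℝ) 1).indicator fun y => -Real.log (1 - ‖y‖)
    with hG
  have hGi : Integrable G := integrable_indicator_neg_log_one_sub_norm hn
  have hG0 : ∀ y, 0 ≤ G y := fun y => Set.indicator_nonneg (fun y hy => by
    rw [mem_ball_zero_iff] at hy
    have := Real.log_nonpos (show 0 ≤ 1 - ‖y‖ by linarith)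
      (by linarith [norm_nonneg y])
    linarith) y
  refine ⟨∫ y, G y, integral_nonneg hG0, fun Q => ?_⟩
  have hh := Q.half_pos
  have heq : ∀ x ∈ Q.toSet, G (Q.half⁻¹ • (x - Q.center)) =
      -Real.log (1 - dist x Q.center / Q.half) := by
    intro x hx
    have hnorm : ‖Q.half⁻¹ • (x - Q.center)‖ = dist x Q.center / Q.half := by
      rw [norm_smul, norm_inv, Real.norm_of_nonneg hh.le, dist_eq_norm, div_eq_inv_mul]
    have hx' : dist x Q.center ≤ Q.half := hx
    rcases hx'.lt_or_eq with h | h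
    · rw [hG, Set.indicator_of_mem, hnorm]
      rw [mem_ball_zero_iff, hnorm]
      exact (div_lt_one hh).2 h
    · rw [hG, Set.indicator_of_notMem, h, div_self hh.ne']
      · simp
      · rw [mem_ball_zero_iff, hnorm, h, div_self hh.ne']
        exact lt_irrefl _
  have hint : Integrable fun x => G (Q.half⁻¹ • (x - Q.center)) :=
    (hGi.comp_smul (inv_ne_zero hh.ne')).comp_sub_right Q.center
  have hval : ∫ x, G (Q.half⁻¹ • (x - Q.center)) = Q.half ^ n * ∫ y, G y := by
    rw [integral_sub_right_eq_self (fun x => G (Q.half⁻¹ • x)),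
      Measure.integral_comp_inv_smul_of_nonneg _ _ hh.le]
    simp
  constructor
  · exact hint.integrableOn.congr_fun heq Q.measurableSet_toSet
  · rw [← Q.integral_unif_congr heq, Q.integral_unif]
    have h1 : ∫ x in Q.toSet, G (Q.half⁻¹ • (x - Q.center)) ≤ Q.half ^ n * ∫ y, G y := by
      rw [← hval]
      exact setIntegral_le_integral hint (Eventually.of_forall fun _ => hG0 _)
    calc ((2 * Q.half) ^ n)⁻¹ * ∫ x in Q.toSet, G (Q.half⁻¹ • (x - Q.center))
        ≤ ((2 * Q.half) ^ n)⁻¹ * (Q.half ^ n * ∫ y, G y) := by gcongr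
      _ = (2 ^ n)⁻¹ * ∫ y, G y := by rw [mul_pow]; field_simp
      _ ≤ ∫ y, G y := mul_le_of_le_one_left (integral_nonneg hG0)
        (inv_le_one_of_one_le₀ (one_le_pow₀ one_le_two))

/-- A slowly varying function, vanishing at the points of the ball of radius `R` at distance at
least `τ` from the boundary of `U`, and equal to `1` very close to the boundary and far away. -/
def outerCutoff (U : Set (Fin n → ℝ)) (s σ τ R : ℝ) (x : Fin n → ℝ) : ℝ :=
  min 1 (s * max 0 (Real.log (logWeight (distBd U x)) - Real.log (logWeight τ)) +
    σ * max 0 (dist x 0 - R))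

section outerCutoff

variable {U : Set (Fin n → ℝ)} {s σ τ R : ℝ}

lemma outerCutoff_nonneg (hs : 0 ≤ s) (hσ : 0 ≤ σ) (x : Fin n → ℝ) :
    0 ≤ outerCutoff U s σ τ R x := by
  unfold outerCutoff
  positivity

lemma outerCutoff_le_one (x : Fin n → ℝ) : outerCutoff U s σ τ R x ≤ 1 := min_le_left _ _

lemma measurable_outerCutoff : Measurable (outerCutoff U s σ τ R) := by
  have : Measurable (distBd U) := (continuous_distBd U).measurable
  unfold outerCutoff logWeight
  fun_prop

lemma outerCutoff_eq_zero (hτ : 0 < τ) {x : Fin n → ℝ} (h1 : τ ≤ distBd U x) (h2 : dist x 0 ≤ R) :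
    outerCutoff U s σ τ R x = 0 := by
  have h3 := Real.log_le_log (by linarith [one_le_logWeight (distBd_nonneg U x)])
    (logWeight_anti hτ h1)
  rw [outerCutoff, max_eq_left (by linarith), max_eq_left (by linarith)]
  simp

lemma abs_outerCutoff_sub_le (hs : 0 ≤ s) (hσ : 0 ≤ σ) (x y : Fin n → ℝ) :
    |outerCutoff U s σ τ R x - outerCutoff U s σ τ R y| ≤
      s * |Real.log (logWeight (distBd U x)) - Real.log (logWeight (distBd U y))| +
        σ * dist x y := by
  unfold outerCutoff
  set p := Real.log (logWeight (distBd U x))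
  set q := Real.log (logWeight (distBd U y))
  set w := Real.log (logWeight τ)
  have h1 : |max 0 (p - w) - max 0 (q - w)| ≤ |p - q| := by
    refine (abs_max_sub_max_le_max _ _ _ _).trans ?_
    simp
  have h2 : |max 0 (dist x 0 - R) - max 0 (dist y 0 - R)| ≤ dist x y := by
    refine (abs_max_sub_max_le_max _ _ _ _).trans ?_
    simpa using abs_dist_sub_le x y 0
  refine (abs_min_sub_min_le_max _ _ _ _).trans ?_
  rw [sub_self, abs_zero, max_eq_right (abs_nonneg _)]
  calc _ = |s * (max 0 (p - w) - max 0 (q - w)) +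
        σ * (max 0 (dist x 0 - R) - max 0 (dist y 0 - R))| := by ring_nf
    _ ≤ _ := by
      refine (abs_add_le _ _).trans ?_
      rw [abs_mul, abs_mul, abs_of_nonneg hs, abs_of_nonneg hσ]
      gcongr

end outerCutoff

lemma exists_integral_abs_outerCutoff_sub_le (hn : 0 < n) :
    ∃ B : ℝ, 0 ≤ B ∧ ∀ (U : Set (Fin n → ℝ)) (s σ τ R : ℝ) (Q : Cube n), IsOpen U →
      (frontier U).Nonempty → 0 ≤ s → 0 ≤ σ → Q.toSet ⊆ U →
      (∫ x, |outerCutoff U s σ τ R x - outerCutoff U s σ τ R Q.center| ∂Q.unif) *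
        logWeight Q.half ≤ s * B + σ * (Q.half + 1) := by
  obtain ⟨B, hB, hQB⟩ := Cube.exists_integral_neg_log_depth_le hn
  refine ⟨2 * (1 + B), by positivity, fun U s σ τ R Q hU hne hs hσ hQ => ?_⟩
  obtain ⟨hi, hb⟩ := hQB Q
  have hh := Q.half_pos
  have hW := one_le_logWeight hh.le
  have : NeZero n := ⟨hn.ne'⟩
  have hsph : ∀ᵐ x ∂(volume : Measure (Fin n → ℝ)), x ∉ sphere Q.center Q.half :=
    measure_eq_zero_iff_ae_notMem.1 (Measure.addHaar_sphere volume _ _)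
  have hi' := Q.integrable_unif hi
  rw [← integral_mul_const]
  have hpt : ∀ᵐ x ∂Q.unif,
      |outerCutoff U s σ τ R x - outerCutoff U s σ τ R Q.center| * logWeight Q.half ≤
        s * (2 * (1 + -Real.log (1 - dist x Q.center / Q.half))) + σ * (Q.half + 1) := by
    filter_upwards [Q.ae_mem_unif, Q.ae_unif_of_ae hsph] with x hx hxs
    have hd : dist x Q.center < Q.half := lt_of_le_of_ne hx hxs
    have h1 := abs_outerCutoff_sub_le (U := U) (τ := τ) (R := R) hs hσ x Q.center
    have hv : 0 < 1 - dist x Q.center / Q.half := by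
      rw [sub_pos, div_lt_one hh]; exact hd
    have hv1 : 1 - dist x Q.center / Q.half ≤ 1 := by
      have : 0 ≤ dist x Q.center / Q.half := by positivity
      linarith
    have h2 := abs_log_logWeight_sub_mul_le (p := distBd U x) hh
      (Cube.half_le_distBd_center hU hne hQ) hv hv1 (by
        rw [sub_sub_cancel, mul_div_cancel₀ _ hh.ne', abs_sub_le_iff]
        have h3 := distBd_le_add U x Q.center
        have h4 := distBd_le_add U Q.center x
        rw [dist_comm] at h4
        constructor <;> linarith)
    have h3 := mul_logWeight_le hh
    calc _ ≤ (s * |Real.log (logWeight (distBd U x)) -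
          Real.log (logWeight (distBd U Q.center))| + σ * dist x Q.center) * logWeight Q.half := by
          gcongr
      _ = s * (|Real.log (logWeight (distBd U x)) -
          Real.log (logWeight (distBd U Q.center))| * logWeight Q.half) +
          σ * (dist x Q.center * logWeight Q.half) := by ring
      _ ≤ s * (2 * (1 - Real.log (1 - dist x Q.center / Q.half))) +
          σ * (Q.half * logWeight Q.half) := by gcongr
      _ ≤ _ := by
          rw [← sub_eq_add_neg]
          gcongr
  have hint : Integrable (fun x => s * (2 * (1 + -Real.log (1 - dist x Q.center / Q.half))) +
      σ * (Q.half + 1)) Q.unif :=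
    ((((integrable_const (1 : ℝ)).add hi').const_mul 2).const_mul s).add (integrable_const _)
  refine (integral_mono_of_nonneg (Eventually.of_forall fun x => by positivity) hint hpt).trans ?_
  have e : ∫ x, (s * (2 * (1 + -Real.log (1 - dist x Q.center / Q.half)))) ∂Q.unif =
      s * (2 * (1 + ∫ x, -Real.log (1 - dist x Q.center / Q.half) ∂Q.unif)) := by
    rw [integral_const_mul, integral_const_mul, integral_add (integrable_const _) hi']
    simp
  rw [integral_add (f := fun x => s * (2 * (1 + -Real.log (1 - dist x Q.center / Q.half))))
    ((((integrable_const (1 : ℝ)).add hi').const_mul 2).const_mul s)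
    (integrable_const _)]
  rw [e]
  simp only [integral_const, probReal_univ, one_smul]
  gcongr

namespace Cube

/-- The subcubes in the subdivision of a cube into `m ^ n` congruent cubes. -/
def grid (Q : Cube n) (m : ℕ) [NeZero m] (i : Fin n → Fin m) : Cube n where
  center k := Q.center k - Q.half + (2 * (i k : ℕ) + 1) * (Q.half / m)
  half := Q.half / m
  half_pos := div_pos Q.half_pos (Nat.cast_pos.2 (NeZero.pos m))

variable (Q : Cube n) (m : ℕ) [NeZero m]

lemma mem_grid_iff {i : Fin n → Fin m} {x : Fin n → ℝ} :
    x ∈ (Q.grid m i).toSet ↔ ∀ k, 2 * (i k : ℕ) * (Q.half / m) ≤ x k - Q.center k + Q.half ∧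
      x k - Q.center k + Q.half ≤ 2 * ((i k : ℕ) + 1) * (Q.half / m) := by
  have h := (Q.grid m i).half_pos.le
  rw [toSet, mem_closedBall, dist_pi_le_iff h]
  refine forall_congr' fun k => ?_
  rw [Real.dist_eq, abs_le]
  simp only [grid]
  constructor <;> rintro ⟨h1, h2⟩ <;> constructor <;> linarith

lemma grid_subset (i : Fin n → Fin m) : (Q.grid m i).toSet ⊆ Q.toSet := by
  intro x hx
  rw [mem_grid_iff] at hx
  rw [toSet, mem_closedBall, dist_pi_le_iff Q.half_pos.le]
  intro k
  obtain ⟨h1, h2⟩ := hx k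
  have hm : (0 : ℝ) < m := Nat.cast_pos.2 (NeZero.pos m)
  have hi : ((i k : ℕ) : ℝ) + 1 ≤ m := by exact_mod_cast (i k).2
  have hu := (Q.grid m i).half_pos
  simp only [grid] at hu
  have h3 : (((i k : ℕ) : ℝ) + 1) * (Q.half / m) ≤ m * (Q.half / m) := by gcongr
  rw [mul_div_cancel₀ _ hm.ne'] at h3
  have h4 : 0 ≤ 2 * ((i k : ℕ) : ℝ) * (Q.half / m) := by positivity
  rw [Real.dist_eq, abs_le]
  constructor <;> linarith

lemma subset_iUnion_grid : Q.toSet ⊆ ⋃ i, (Q.grid m i).toSet := by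
  intro x hx
  rw [toSet, mem_closedBall, dist_pi_le_iff Q.half_pos.le] at hx
  have hm : (0 : ℝ) < m := Nat.cast_pos.2 (NeZero.pos m)
  have hm1 : (1 : ℝ) ≤ m := Nat.one_le_cast.2 (NeZero.pos m)
  have hu : 0 < Q.half / m := div_pos Q.half_pos hm
  rw [Set.mem_iUnion]
  set j : Fin n → ℕ := fun k => ⌊(x k - Q.center k + Q.half) / (2 * (Q.half / m))⌋₊ with hj
  refine ⟨fun k => ⟨min (j k) (m - 1), by have := NeZero.pos m; omega⟩, ?_⟩
  rw [mem_grid_iff]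
  intro k
  have hk := hx k
  rw [Real.dist_eq, abs_le] at hk
  have h0 : 0 ≤ (x k - Q.center k + Q.half) / (2 * (Q.half / m)) :=
    div_nonneg (by linarith) (by positivity)
  have h1 := Nat.floor_le h0
  have h2 := Nat.lt_floor_add_one ((x k - Q.center k + Q.half) / (2 * (Q.half / m)))
  rw [le_div_iff₀ (by positivity)] at h1
  rw [div_lt_iff₀ (by positivity)] at h2
  have e : (m : ℝ) * (Q.half / m) = Q.half := mul_div_cancel₀ _ hm.ne'
  simp only
  rcases le_total (j k) (m - 1) with h | h
  · rw [min_eq_left h]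
    constructor
    · linarith
    · linarith
  · rw [min_eq_right h]
    have h3 : ((m - 1 : ℕ) : ℝ) ≤ j k := Nat.cast_le.2 h
    constructor
    · have : ((m - 1 : ℕ) : ℝ) * (2 * (Q.half / m)) ≤ j k * (2 * (Q.half / m)) := by gcongr
      linarith
    · rw [Nat.cast_sub (NeZero.pos m), Nat.cast_one, sub_add_cancel, mul_assoc, e]
      linarith

lemma integral_unif_le_sum_grid {F : (Fin n → ℝ) → ℝ} (hF : IntegrableOn F Q.toSet)
    (h0 : ∀ x, 0 ≤ F x) :
    ∫ x, F x ∂Q.unif ≤ ((m : ℝ) ^ n)⁻¹ * ∑ i, ∫ x, F x ∂(Q.grid m i).unif := by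
  have hm : (0 : ℝ) < m := Nat.cast_pos.2 (NeZero.pos m)
  have hh := Q.half_pos
  have hi : ∀ i ∈ Finset.univ, Integrable F (volume.restrict (Q.grid m i).toSet) :=
    fun i _ => hF.mono_set (Q.grid_subset m i)
  have h1 : ∫ x in Q.toSet, F x ≤ ∑ i, ∫ x in (Q.grid m i).toSet, F x := by
    rw [← integral_finsetSum_measure hi]
    refine integral_mono_measure ?_ (Eventually.of_forall h0) (integrable_finsetSum_measure.2 hi)
    rw [← Measure.sum_fintype]
    exact (Measure.restrict_mono (Q.subset_iUnion_grid m) le_rfl).trans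
      Measure.restrict_iUnion_le
  have h2 : ∀ i, ∫ x in (Q.grid m i).toSet, F x =
      (2 * (Q.half / m)) ^ n * ∫ x, F x ∂(Q.grid m i).unif := fun i => by
    rw [integral_unif]
    simp only [grid]
    rw [mul_inv_cancel_left₀ (by positivity)]
  simp only [h2, ← Finset.mul_sum] at h1
  rw [integral_unif]
  calc _ ≤ ((2 * Q.half) ^ n)⁻¹ * ((2 * (Q.half / m)) ^ n *
        ∑ i, ∫ x, F x ∂(Q.grid m i).unif) := by gcongr
    _ = _ := by
      rw [← mul_assoc, ← inv_pow, ← mul_pow, ← inv_pow]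
      congr 2
      field_simp

variable {m}

lemma integral_unif_le_of_grid {F : (Fin n → ℝ) → ℝ} (hF : IntegrableOn F Q.toSet)
    (h0 : ∀ x, 0 ≤ F x) {A : ℝ} (hA : ∀ i, ∫ x, F x ∂(Q.grid m i).unif ≤ A) :
    ∫ x, F x ∂Q.unif ≤ A := by
  have hm : (0 : ℝ) < m := Nat.cast_pos.2 (NeZero.pos m)
  refine (Q.integral_unif_le_sum_grid m hF h0).trans ?_
  have := Finset.sum_le_card_nsmul Finset.univ _ A fun i _ => hA i
  rw [Finset.card_univ, Fintype.card_fun, Fintype.card_fin, Fintype.card_fin, nsmul_eq_mul,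
    Nat.cast_pow] at this
  rwa [inv_mul_le_iff₀ (by positivity)]

lemma integral_unif_le_of_grid_of_layer {F : (Fin n → ℝ) → ℝ} (hF : IntegrableOn F Q.toSet)
    (h0 : ∀ x, 0 ≤ F x) (hm2 : 2 ≤ m) {A : ℝ} (hA : ∀ i, ∫ x, F x ∂(Q.grid m i).unif ≤ A)
    (hin : ∀ x, dist x Q.center ≤ Q.half - 2 * (Q.half / m) → F x = 0) :
    ∫ x, F x ∂Q.unif ≤ 2 * n / m * A := by
  have hm : (0 : ℝ) < m := Nat.cast_pos.2 (NeZero.pos m)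
  have hm2' : (2 : ℝ) ≤ m := by exact_mod_cast hm2
  have hh := Q.half_pos
  have hu : 0 < Q.half / m := div_pos hh hm
  have e : (m : ℝ) * (Q.half / m) = Q.half := mul_div_cancel₀ _ hm.ne'
  have hA0 : 0 ≤ A := (integral_nonneg h0).trans (hA 0)
  set S : Finset (Fin m) := {⟨0, by omega⟩, ⟨m - 1, by omega⟩}ᶜ with hS
  have hScard : (m : ℝ) - 2 ≤ S.card := by
    have h1 : m ≤ S.card + 2 := by
      have := Finset.card_le_two (a := (⟨0, by omega⟩ : Fin m)) (b := ⟨m - 1, by omega⟩)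
      rw [hS, Finset.card_compl, Fintype.card_fin]
      omega
    have : (m : ℝ) ≤ S.card + 2 := by exact_mod_cast h1
    linarith
  set I : Finset (Fin n → Fin m) := Fintype.piFinset fun _ => S with hI
  have hzero : ∀ i ∈ I, ∫ x, F x ∂(Q.grid m i).unif = 0 := by
    intro i hi
    rw [hI, Fintype.mem_piFinset] at hi
    rw [(Q.grid m i).integral_unif_congr (G := fun _ => 0) fun x hx => ?_, integral_zero]
    refine hin x ?_
    rw [mem_grid_iff] at hx
    rw [dist_pi_le_iff (by nlinarith)]
    intro k
    have h1 := hi k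
    simp only [hS, Finset.mem_compl, Finset.mem_insert, Finset.mem_singleton, Fin.ext_iff,
      not_or] at h1
    obtain ⟨h2, h3⟩ := hx k
    have h4 : (1 : ℝ) ≤ (i k : ℕ) := by exact_mod_cast Nat.one_le_iff_ne_zero.2 h1.1
    have h5 : ((i k : ℕ) : ℝ) + 2 ≤ m := by
      have := (i k).2
      exact_mod_cast (by omega : (i k : ℕ) + 2 ≤ m)
    have h6 : 1 * (Q.half / m) ≤ (i k : ℕ) * (Q.half / m) := by gcongr
    have h7 : (((i k : ℕ) : ℝ) + 2) * (Q.half / m) ≤ m * (Q.half / m) := by gcongr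
    rw [Real.dist_eq, abs_le]
    constructor <;> linarith
  have hsum : ∑ i, ∫ x, F x ∂(Q.grid m i).unif ≤ ((m : ℝ) ^ n - ((m : ℝ) - 2) ^ n) * A := by
    rw [← Finset.sum_compl_add_sum I, Finset.sum_eq_zero hzero, add_zero]
    refine (Finset.sum_le_card_nsmul _ _ A fun i _ => hA i).trans ?_
    rw [nsmul_eq_mul]
    gcongr
    rw [Finset.card_compl, Fintype.card_fun, Fintype.card_fin, Fintype.card_fin, hI,
      Fintype.card_piFinset_const, Nat.cast_sub, Nat.cast_pow, Nat.cast_pow]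
    · have : ((m : ℝ) - 2) ^ n ≤ (S.card : ℝ) ^ n := by
        gcongr
      linarith
    · have : S.card ≤ m := by simpa using Finset.card_le_univ S
      gcongr
  have hbern : 1 + n * (-2 / m : ℝ) ≤ (1 + -2 / m) ^ n := by
    refine one_add_mul_le_pow ?_ n
    rw [le_div_iff₀ hm]
    linarith
  have h3 : (1 + -2 / (m : ℝ)) ^ n = ((m : ℝ) ^ n)⁻¹ * (m - 2) ^ n := by
    rw [← inv_pow, ← mul_pow]
    congr 1
    field_simp
    ring
  refine (Q.integral_unif_le_sum_grid m hF h0).trans ?_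
  calc _ ≤ ((m : ℝ) ^ n)⁻¹ * (((m : ℝ) ^ n - ((m : ℝ) - 2) ^ n) * A) := by gcongr
    _ = (1 - (1 + -2 / (m : ℝ)) ^ n) * A := by
      rw [h3, ← mul_assoc, mul_sub, inv_mul_cancel₀ (by positivity)]
    _ ≤ _ := by
      gcongr
      have : n * (-2 / m : ℝ) = - (2 * n / m) := by ring
      linarith

end Cube

lemma avgAbs_le_of_eq_zero_of_le_distBd {U : Set (Fin n → ℝ)} (hU : IsOpen U)
    (hne : (frontier U).Nonempty) {f g : (Fin n → ℝ) → ℝ} {C τ : ℝ} (hτ : 0 < τ) (hC : 0 ≤ C)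
    {Q : Cube n} (hQ : Q.toSet ⊆ U) (hf : IntegrableOn f Q.toSet)
    (hlog : ∀ P : Cube n, P.toSet ⊆ U → P.avgAbs f ≤ C * logWeight P.half)
    (hg : IntegrableOn g Q.toSet) (hgf : ∀ x ∈ Q.toSet, |g x| ≤ |f x|)
    (hin : ∀ x ∈ Q.toSet, τ ≤ distBd U x → g x = 0) (hτQ : 2 * τ ≤ Q.half) :
    Q.avgAbs g ≤ 4 * n * C / Q.half * (τ * logWeight τ) := by
  have hh := Q.half_pos
  have hW := one_le_logWeight hτ.le
  set m := ⌊Q.half / τ⌋₊ with hm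
  have h1 : (m : ℝ) ≤ Q.half / τ := Nat.floor_le (by positivity)
  have h2 : Q.half / τ < m + 1 := Nat.lt_floor_add_one _
  have h2τ : 2 ≤ Q.half / τ := by rwa [le_div_iff₀ hτ]
  have hm2 : 2 ≤ m := Nat.le_floor (by exact_mod_cast h2τ)
  have : NeZero m := ⟨by omega⟩
  have hm0 : (0 : ℝ) < m := Nat.cast_pos.2 (NeZero.pos m)
  have hτm : τ ≤ Q.half / m := by
    rw [le_div_iff₀ hm0, mul_comm]
    rwa [le_div_iff₀ hτ] at h1
  have hu : 0 < Q.half / m := div_pos hh hm0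
  have key := Q.integral_unif_le_of_grid_of_layer (F := fun x => |g x|) (m := m)
    (A := C * logWeight τ) hg.abs (fun x => abs_nonneg _) hm2 (fun i => ?_) (fun x hx => ?_)
  · refine key.trans ?_
    have h3 : (m : ℝ)⁻¹ ≤ 2 * τ / Q.half := by
      rw [inv_eq_one_div, div_le_div_iff₀ hm0 hh]
      rw [div_lt_iff₀ hτ] at h2
      have : (2 : ℝ) ≤ m := by exact_mod_cast hm2
      nlinarith
    calc 2 * n / m * (C * logWeight τ) = 2 * n * (m : ℝ)⁻¹ * (C * logWeight τ) := by
          rw [div_eq_mul_inv]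
      _ ≤ 2 * n * (2 * τ / Q.half) * (C * logWeight τ) := by gcongr
      _ = _ := by ring
  · have hP := Q.grid_subset m i
    have h4 : (Q.grid m i).avgAbs g ≤ (Q.grid m i).avgAbs f :=
      Cube.integral_unif_mono _ (hg.mono_set hP).abs (hf.mono_set hP).abs fun x hx => hgf x (hP hx)
    refine (h4.trans (hlog _ (hP.trans hQ))).trans ?_
    gcongr
    exact logWeight_anti hτ hτm
  · have h5 := Cube.half_le_distBd_center hU hne hQ
    have h6 := distBd_le_add U Q.center x
    rw [dist_comm] at h6
    have h7 : x ∈ Q.toSet := by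
      rw [Cube.toSet, mem_closedBall]
      linarith
    simp only [hin x h7 (by linarith), abs_zero]

lemma tendsto_mul_logWeight :
    Tendsto (fun τ => τ * logWeight τ) (𝓝[>] 0) (𝓝 0) := by
  have h1 : Tendsto (fun τ : ℝ => τ + 2 * √(τ ^ 2 + τ)) (𝓝[>] 0) (𝓝 0) := by
    have : Continuous fun τ : ℝ => τ + 2 * √(τ ^ 2 + τ) := by fun_prop
    have h := this.tendsto 0
    simp only [ne_eq, OfNat.ofNat_ne_zero, not_false_eq_true, zero_pow, add_zero, Real.sqrt_zero,
      mul_zero] at h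
    exact h.mono_left nhdsWithin_le_nhds
  refine squeeze_zero' ?_ ?_ h1
  · filter_upwards [self_mem_nhdsWithin] with τ hτ
    exact mul_nonneg (le_of_lt hτ) (zero_le_one.trans (one_le_logWeight (le_of_lt hτ)))
  · filter_upwards [self_mem_nhdsWithin] with τ hτ
    have hτ : 0 < τ := hτ
    have h2 : Real.log (1 + τ⁻¹) ≤ 2 * √(1 + τ⁻¹) := by
      have h3 := Real.log_le_sub_one_of_pos (x := √(1 + τ⁻¹)) (by positivity)
      rw [Real.log_sqrt (by positivity)] at h3
      linarith
    have h4 : τ * √(1 + τ⁻¹) = √(τ ^ 2 + τ) := by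
      rw [← Real.sqrt_sq hτ.le, ← Real.sqrt_mul (by positivity), Real.sqrt_sq hτ.le]
      congr 1
      field_simp
    rw [logWeight, ← h4]
    nlinarith

lemma omegaOn_nonneg (U : Set (Fin n → ℝ)) (f : (Fin n → ℝ) → ℝ) (t : ℝ) : 0 ≤ omegaOn U f t := by
  refine Real.sSup_nonneg ?_
  rintro _ ⟨Q, -, -, rfl⟩
  exact Q.osc_nonneg f

lemma bigAvgSup_nonneg (U : Set (Fin n → ℝ)) (lam : ℝ) (f : (Fin n → ℝ) → ℝ) :
    0 ≤ bigAvgSup U lam f := by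
  refine Real.sSup_nonneg ?_
  rintro _ ⟨Q, -, -, rfl⟩
  exact Q.avgAbs_nonneg f

lemma bmoNorm_nonneg (U : Set (Fin n → ℝ)) (lam : ℝ) (f : (Fin n → ℝ) → ℝ) :
    0 ≤ bmoNorm U lam f :=
  add_nonneg (omegaOn_nonneg U f lam) (bigAvgSup_nonneg U lam f)

lemma omegaOn_le_bmoNorm (U : Set (Fin n → ℝ)) (lam : ℝ) (f : (Fin n → ℝ) → ℝ) :
    omegaOn U f lam ≤ bmoNorm U lam f :=
  le_add_of_nonneg_right (bigAvgSup_nonneg U lam f)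

lemma bigAvgSup_le_bmoNorm (U : Set (Fin n → ℝ)) (lam : ℝ) (f : (Fin n → ℝ) → ℝ) :
    bigAvgSup U lam f ≤ bmoNorm U lam f :=
  le_add_of_nonneg_left (omegaOn_nonneg U f lam)

lemma bmoNorm_le {U : Set (Fin n → ℝ)} {lam a b : ℝ} {f : (Fin n → ℝ) → ℝ} (ha : 0 ≤ a)
    (hb : 0 ≤ b) (hosc : ∀ Q : Cube n, Q.toSet ⊆ U → Q.side < lam → Q.osc f ≤ a)
    (hbig : ∀ Q : Cube n, Q.toSet ⊆ U → lam ≤ Q.side → Q.avgAbs f ≤ b) :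
    bmoNorm U lam f ≤ a + b := by
  refine add_le_add (Real.sSup_le ?_ ha) (Real.sSup_le ?_ hb)
  · rintro _ ⟨Q, h1, h2, rfl⟩
    exact hosc Q h1 h2
  · rintro _ ⟨Q, h1, h2, rfl⟩
    exact hbig Q h1 h2

namespace MemBmo

variable {U V : Set (Fin n → ℝ)} {lam : ℝ} {f g : (Fin n → ℝ) → ℝ}

lemma mono_set (h : MemBmo U lam f) (hV : V ⊆ U) : MemBmo V lam f := by
  refine ⟨fun Q hQ => h.1 Q (hQ.trans hV), h.2.1.mono ?_, h.2.2.mono ?_⟩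
  · rintro _ ⟨Q, h1, h2, rfl⟩
    exact ⟨Q, h1.trans hV, h2, rfl⟩
  · rintro _ ⟨Q, h1, h2, rfl⟩
    exact ⟨Q, h1.trans hV, h2, rfl⟩

lemma osc_le (h : MemBmo U lam f) {Q : Cube n} (hQ : Q.toSet ⊆ U) (hs : Q.side < lam) :
    Q.osc f ≤ omegaOn U f lam :=
  le_csSup h.2.1 ⟨Q, hQ, hs, rfl⟩

lemma avgAbs_le (h : MemBmo U lam f) {Q : Cube n} (hQ : Q.toSet ⊆ U) (hs : lam ≤ Q.side) :
    Q.avgAbs f ≤ bigAvgSup U lam f :=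
  le_csSup h.2.2 ⟨Q, hQ, hs, rfl⟩

lemma sub (hf : MemBmo U lam f) (hg : MemBmo U lam g) : MemBmo U lam (f - g) := by
  refine ⟨fun Q hQ => (hf.1 Q hQ).sub (hg.1 Q hQ), ⟨omegaOn U f lam + omegaOn U g lam, ?_⟩,
    ⟨bigAvgSup U lam f + bigAvgSup U lam g, ?_⟩⟩
  · rintro _ ⟨Q, h1, h2, rfl⟩
    exact (Q.osc_sub_le (hf.1 Q h1) (hg.1 Q h1)).trans
      (add_le_add (hf.osc_le h1 h2) (hg.osc_le h1 h2))
  · rintro _ ⟨Q, h1, h2, rfl⟩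
    exact (Q.avgAbs_sub_le (hf.1 Q h1) (hg.1 Q h1)).trans
      (add_le_add (hf.avgAbs_le h1 h2) (hg.avgAbs_le h1 h2))

lemma congr (hf : MemBmo U lam f) (h : ∀ x ∈ U, f x = g x) : MemBmo U lam g := by
  refine ⟨fun Q hQ => (hf.1 Q hQ).congr_fun (fun x hx => h x (hQ hx)) Q.measurableSet_toSet,
    ⟨omegaOn U f lam, ?_⟩, ⟨bigAvgSup U lam f, ?_⟩⟩
  · rintro _ ⟨Q, h1, h2, rfl⟩
    exact (Q.osc_congr fun x hx => h x (h1 hx)).symm.le.trans (hf.osc_le h1 h2)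
  · rintro _ ⟨Q, h1, h2, rfl⟩
    exact (Q.avgAbs_congr fun x hx => h x (h1 hx)).symm.le.trans (hf.avgAbs_le h1 h2)

lemma exists_oscBound (h : MemBmo U lam f) : ∃ C : ℝ, 0 ≤ C ∧ OscBound U f C ∧
    ∀ Q : Cube n, Q.toSet ⊆ U → lam ≤ Q.side → Q.avgAbs f ≤ C := by
  have h0 := bmoNorm_nonneg U lam f
  have h1 := omegaOn_le_bmoNorm U lam f
  have h2 := bigAvgSup_le_bmoNorm U lam f
  refine ⟨2 * bmoNorm U lam f, by positivity, fun Q hQ => ⟨h.1 Q hQ, ?_⟩, fun Q hQ hs => ?_⟩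
  · rcases lt_or_ge Q.side lam with hs | hs
    · linarith [h.osc_le hQ hs]
    · linarith [Q.osc_le_two_mul_avgAbs (h.1 Q hQ), h.avgAbs_le hQ hs]
  · linarith [h.avgAbs_le hQ hs]

lemma bmoNorm_le_bmoNorm_sub (hf : MemBmo U lam f) (hg : MemBmo U lam g) (hV : V ⊆ U)
    (h0 : ∀ x ∈ V, g x = 0) : bmoNorm V lam f ≤ bmoNorm U lam (f - g) := by
  have hfg := hf.sub hg
  have e : ∀ x ∈ V, f x = (f - g) x := fun x hx => by simp [h0 x hx]
  refine bmoNorm_le (omegaOn_nonneg ..) (bigAvgSup_nonneg ..) (fun Q hQ hs => ?_)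
    fun Q hQ hs => ?_
  · rw [Q.osc_congr fun x hx => e x (hQ hx)]
    exact hfg.osc_le (hQ.trans hV) hs
  · rw [Q.avgAbs_congr fun x hx => e x (hQ hx)]
    exact hfg.avgAbs_le (hQ.trans hV) hs

end MemBmo

lemma bmoNorm_congr {U : Set (Fin n → ℝ)} {lam : ℝ} {f g : (Fin n → ℝ) → ℝ}
    (h : ∀ x ∈ U, f x = g x) : bmoNorm U lam f = bmoNorm U lam g := by
  have h1 : ∀ Q : Cube n, Q.toSet ⊆ U → Q.osc f = Q.osc g := fun Q hQ =>
    Q.osc_congr fun x hx => h x (hQ hx)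
  have h2 : ∀ Q : Cube n, Q.toSet ⊆ U → Q.avgAbs f = Q.avgAbs g := fun Q hQ =>
    Q.avgAbs_congr fun x hx => h x (hQ hx)
  unfold bmoNorm omegaOn bigAvgSup
  congr 2
  · ext r
    exact exists_congr fun Q => and_congr_right fun hQ => by rw [h1 Q hQ]
  · ext r
    exact exists_congr fun Q => and_congr_right fun hQ => by rw [h2 Q hQ]

lemma exists_le_distBd_of_isCompact {U K : Set (Fin n → ℝ)} (hU : IsOpen U)
    (hne : (frontier U).Nonempty) (hK : IsCompact K) (hKU : K ⊆ U) :
    ∃ t : ℝ, 0 < t ∧ ∀ x ∈ K, t ≤ distBd U x :=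
  hK.exists_forall_le' (continuous_distBd U).continuousOn fun _ hx => distBd_pos hU hne (hKU hx)

section Vanish

variable {U : Set (Fin n → ℝ)} {lam : ℝ} {f : (Fin n → ℝ) → ℝ} {F : ℕ → (Fin n → ℝ) → ℝ}

lemma vanishAtBoundary_of_tendsto (hU : IsOpen U) (hne : (frontier U).Nonempty)
    (hf : MemBmo U lam f) (hF : ∀ k, MemBmo U lam (F k))
    (hK : ∀ k, IsCompact (tsupport (F k))) (hKU : ∀ k, tsupport (F k) ⊆ U)
    (hlim : Tendsto (fun k => bmoNorm U lam (f - F k)) atTop (𝓝 0)) :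
    VanishAtBoundary U lam f := by
  rw [VanishAtBoundary, Metric.tendsto_nhds]
  intro η hη
  obtain ⟨k, hk⟩ := (hlim.eventually_lt_const hη).exists
  obtain ⟨t, ht, hd⟩ := exists_le_distBd_of_isCompact hU hne (hK k) (hKU k)
  filter_upwards [Ioo_mem_nhdsGT ht] with r hr
  rw [dist_zero_right, Real.norm_of_nonneg (bmoNorm_nonneg _ _ _)]
  refine (hf.bmoNorm_le_bmoNorm_sub (hF k) Set.sdiff_subset fun x hx => ?_).trans_lt hk
  refine image_eq_zero_of_notMem_tsupport fun hxK => hx.2 ⟨hx.1, ?_⟩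
  exact hr.2.le.trans (hd x hxK)

lemma vanishAtInfinity_of_tendsto (hf : MemBmo U lam f) (hF : ∀ k, MemBmo U lam (F k))
    (hK : ∀ k, IsCompact (tsupport (F k)))
    (hlim : Tendsto (fun k => bmoNorm U lam (f - F k)) atTop (𝓝 0)) :
    VanishAtInfinity U lam f := by
  rw [VanishAtInfinity, Metric.tendsto_nhds]
  intro η hη
  obtain ⟨k, hk⟩ := (hlim.eventually_lt_const hη).exists
  obtain ⟨R, hR⟩ := (hK k).isBounded.subset_closedBall 0
  filter_upwards [eventually_ge_atTop R] with r hr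
  rw [dist_zero_right, Real.norm_of_nonneg (bmoNorm_nonneg _ _ _)]
  refine (hf.bmoNorm_le_bmoNorm_sub (hF k) Set.sdiff_subset fun x hx => ?_).trans_lt hk
  exact image_eq_zero_of_notMem_tsupport fun hxK => hx.2 (closedBall_subset_closedBall hr (hR hxK))

end Vanish

lemma Cube.osc_mul_le (Q : Cube n) {f κ : (Fin n → ℝ) → ℝ} (hf : IntegrableOn f Q.toSet)
    (hκ : Measurable κ) (h0 : ∀ x, 0 ≤ κ x) (h1 : ∀ x, κ x ≤ 1)
    (hfκ : IntegrableOn (fun x => f x * κ x) Q.toSet) (c : ℝ) :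
    Q.osc (fun x => f x * κ x) ≤ 2 * (Q.osc f + |Q.avg f| * ∫ x, |κ x - c| ∂Q.unif) := by
  have hκi : Integrable κ Q.unif := Integrable.of_bound hκ.aestronglyMeasurable 1
    (Eventually.of_forall fun x => by rw [Real.norm_of_nonneg (h0 x)]; exact h1 x)
  have hκc : Integrable (fun x => |κ x - c|) Q.unif := (hκi.sub (integrable_const c)).abs
  refine (Q.osc_le_two_mul hfκ (Q.avg f * c)).trans ?_
  gcongr
  rw [osc_eq, ← integral_const_mul, ← integral_add (Q.integrable_unif_abs_sub_const hf _)
    (hκc.const_mul _)]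
  refine integral_mono (Q.integrable_unif_abs_sub_const hfκ _)
    ((Q.integrable_unif_abs_sub_const hf _).add (hκc.const_mul _)) fun x => ?_
  have e : f x * κ x - Q.avg f * c = (f x - Q.avg f) * κ x + Q.avg f * (κ x - c) := by ring
  simp only [e]
  refine (abs_add_le _ _).trans ?_
  rw [abs_mul, abs_mul, abs_of_nonneg (h0 x)]
  gcongr
  exact mul_le_of_le_one_right (abs_nonneg _) (h1 x)

lemma isCompact_closure_inter_le_distBd (U : Set (Fin n → ℝ)) (t R : ℝ) :
    IsCompact ((closure U ∩ {x | t ≤ distBd U x}) ∩ closedBall 0 R) :=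
  (isCompact_closedBall 0 R).inter_left
    (isClosed_closure.inter (isClosed_le continuous_const (continuous_distBd U)))

lemma closure_inter_le_distBd_subset {U : Set (Fin n → ℝ)} {t : ℝ}
    (ht : 0 < t) : closure U ∩ {x | t ≤ distBd U x} ⊆ U := by
  rintro x ⟨hx, htx⟩
  by_contra hxU
  have hfr : x ∈ frontier U := ⟨hx, fun h => hxU (interior_subset h)⟩
  have h1 : distBd U x = 0 := infDist_zero_of_mem hfr
  rw [Set.mem_ofPred_eq, h1] at htx
  linarith

lemma exists_support_one_sub_outerCutoff_subset {U : Set (Fin n → ℝ)} (hU : IsOpen U)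
    (hne : (frontier U).Nonempty) {s σ : ℝ} (hs : 0 < s) (hσ : 0 < σ) (τ R : ℝ) :
    ∃ t R' : ℝ, 0 < t ∧ ∀ x ∈ U, outerCutoff U s σ τ R x ≠ 1 → t ≤ distBd U x ∧ dist x 0 ≤ R' := by
  set L := Real.log (logWeight τ) + s⁻¹ with hL
  refine ⟨(Real.exp (Real.exp L))⁻¹, R + σ⁻¹, by positivity, fun x hx hκ => ?_⟩
  have h1 : s * max 0 (Real.log (logWeight (distBd U x)) - Real.log (logWeight τ)) +
      σ * max 0 (dist x 0 - R) < 1 := by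
    by_contra! h
    exact hκ (min_eq_left h)
  have hd := distBd_pos hU hne hx
  have h2 : 0 ≤ s * max 0 (Real.log (logWeight (distBd U x)) - Real.log (logWeight τ)) := by
    positivity
  have h3 : 0 ≤ σ * max 0 (dist x 0 - R) := by positivity
  have h4 : s * (Real.log (logWeight (distBd U x)) - Real.log (logWeight τ)) < 1 :=
    (mul_le_mul_of_nonneg_left (le_max_right _ _) hs.le).trans_lt (by linarith)
  have h5 : σ * (dist x 0 - R) < 1 :=
    (mul_le_mul_of_nonneg_left (le_max_right _ _) hσ.le).trans_lt (by linarith)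
  rw [← lt_inv_mul_iff₀ hσ, mul_one] at h5
  rw [← lt_inv_mul_iff₀ hs, mul_one] at h4
  refine ⟨?_, by linarith⟩
  by_contra! h
  have h6 := logWeight_anti hd h.le
  have h7 : Real.exp L < logWeight (Real.exp (Real.exp L))⁻¹ := by
    rw [logWeight, inv_inv]
    have := Real.log_le_log (Real.exp_pos _) (le_add_of_nonneg_left zero_le_one :
      Real.exp (Real.exp L) ≤ 1 + Real.exp (Real.exp L))
    rw [Real.log_exp] at this
    linarith
  have h8 := (Real.lt_log_iff_exp_lt (zero_lt_one.trans_le (one_le_logWeight hd.le))).2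
    (h7.trans_le h6)
  linarith

namespace Cube

lemma dist_le_of_mem {Q : Cube n} {x y : Fin n → ℝ} (hx : x ∈ Q.toSet) (hy : y ∈ Q.toSet) :
    dist x y ≤ 2 * Q.half := by
  have h1 := dist_triangle_right x y Q.center
  have h2 : dist x Q.center ≤ Q.half := hx
  have h3 : dist y Q.center ≤ Q.half := hy
  linarith

/-- A cube either avoids a ball about the origin or lies in a slightly larger one. -/
lemma subset_diff_closedBall_or {U : Set (Fin n → ℝ)} {Q : Cube n} (hQ : Q.toSet ⊆ U)
    (R : ℝ) {r : ℝ} (hr : Q.half ≤ r) :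
    Q.toSet ⊆ U \ closedBall 0 R ∨ ∀ x ∈ Q.toSet, dist x 0 ≤ R + 2 * r := by
  by_cases h : ∃ y ∈ Q.toSet, y ∈ closedBall (0 : Fin n → ℝ) R
  · obtain ⟨y, hy, hyR⟩ := h
    refine Or.inr fun x hx => ?_
    have h1 := dist_triangle x y 0
    have h2 := dist_le_of_mem hx hy
    have h3 : dist y 0 ≤ R := hyR
    linarith
  · push Not at h
    exact Or.inl fun y hy => ⟨hQ hy, h y hy⟩

/-- A large cube is subdivided into cubes of sidelength comparable to a given scale. -/
lemma avgAbs_le_of_grid {U : Set (Fin n → ℝ)} {g : (Fin n → ℝ) → ℝ} {lam A : ℝ} (hlam : 0 < lam)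
    {Q : Cube n} (hQ : Q.toSet ⊆ U) (hg : IntegrableOn g Q.toSet) (hs : lam ≤ Q.side)
    (h : ∀ P : Cube n, P.toSet ⊆ U → P.toSet ⊆ Q.toSet → lam ≤ P.side → P.half ≤ lam →
      P.avgAbs g ≤ A) :
    Q.avgAbs g ≤ A := by
  have hside := Q.side_pos
  have h1 : (⌊Q.side / lam⌋₊ : ℝ) ≤ Q.side / lam := Nat.floor_le (by positivity)
  have h2 : Q.side / lam < ⌊Q.side / lam⌋₊ + 1 := Nat.lt_floor_add_one _
  have hpos : 1 ≤ ⌊Q.side / lam⌋₊ := Nat.le_floor (by simpa using (one_le_div hlam).2 hs)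
  set m := ⌊Q.side / lam⌋₊
  have : NeZero m := ⟨by omega⟩
  have hm0 : (1 : ℝ) ≤ m := by exact_mod_cast hpos
  rw [le_div_iff₀ hlam] at h1
  rw [div_lt_iff₀ hlam] at h2
  simp only [side] at h1 h2
  refine Q.integral_unif_le_of_grid (m := m) hg.abs (fun x => abs_nonneg _) fun i => ?_
  have hP := Q.grid_subset m i
  refine h _ (hP.trans hQ) hP ?_ ?_
  · rw [side, grid, ← mul_div_assoc, le_div_iff₀ (by positivity)]
    linarith
  · rw [grid, div_le_iff₀ (by positivity)]
    nlinarith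

end Cube

lemma exists_outerCutoff_approx (hn : 0 < n) {U : Set (Fin n → ℝ)} (hU : IsOpen U)
    (hne : (frontier U).Nonempty) {f : (Fin n → ℝ) → ℝ} {lam C η R₀ t₀ : ℝ} (hlam : 0 < lam)
    (hC : 0 ≤ C) (hη : 0 < η) (ht₀ : 0 < t₀)
    (hfi : ∀ Q : Cube n, Q.toSet ⊆ U → IntegrableOn f Q.toSet)
    (hlog : ∀ Q : Cube n, Q.toSet ⊆ U → Q.avgAbs f ≤ C * logWeight Q.half)
    (hinf : ∀ Q : Cube n, Q.toSet ⊆ U \ closedBall 0 R₀ →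
      (Q.side < lam → Q.osc f ≤ η) ∧ (lam ≤ Q.side → Q.avgAbs f ≤ η))
    (hbd : ∀ Q : Cube n, Q.toSet ⊆ U \ innerPart U t₀ → Q.side < lam → Q.osc f ≤ η) :
    ∃ s σ τ R : ℝ, 0 < s ∧ 0 < σ ∧ ∀ Q : Cube n, Q.toSet ⊆ U →
      IntegrableOn (fun x => f x * outerCutoff U s σ τ R x) Q.toSet ∧
      (Q.side < lam → Q.osc (fun x => f x * outerCutoff U s σ τ R x) ≤ 4 * η) ∧
      (lam ≤ Q.side → Q.avgAbs (fun x => f x * outerCutoff U s σ τ R x) ≤ η) := by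
  obtain ⟨B, hB, hκosc⟩ := exists_integral_abs_outerCutoff_sub_le hn
  set ρ := min (t₀ / 4) (lam / 2) with hρ
  have hρ0 : 0 < ρ := lt_min (by positivity) (by positivity)
  obtain ⟨τ, hτη, hτ, hτρ⟩ : ∃ τ, 4 * n * C / ρ * (τ * logWeight τ) < η ∧ 0 < τ ∧ τ < ρ / 2 := by
    have h1 := tendsto_mul_logWeight.const_mul (4 * n * C / ρ)
    rw [mul_zero] at h1
    exact ((h1.eventually_lt_const hη).and (Ioo_mem_nhdsGT (half_pos hρ0))).exists
  have hρt : ρ ≤ t₀ / 4 := min_le_left _ _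
  set s := η / (2 * (C + 1) * (B + 1)) with hs
  set σ := η / (2 * (C + 1) * (lam + 1)) with hσ
  have hs0 : 0 < s := by positivity
  have hσ0 : 0 < σ := by positivity
  have hsσ : C * (s * B + σ * (lam + 1)) ≤ η := by
    have h1 : s * (B + 1) = η / (2 * (C + 1)) := by rw [hs]; field_simp
    have h2 : σ * (lam + 1) = η / (2 * (C + 1)) := by rw [hσ]; field_simp
    have h3 : (C + 1) * (s * (B + 1) + σ * (lam + 1)) = η := by
      rw [h1, h2]
      field_simp
      ring
    have h4 : 0 < σ * (lam + 1) := by positivity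
    calc _ ≤ (C + 1) * (s * (B + 1) + σ * (lam + 1)) := by
          gcongr <;> linarith
      _ = η := h3
  set κ := outerCutoff U s σ τ (R₀ + 2 * lam) with hκ
  have hκ0 : ∀ x, 0 ≤ κ x := outerCutoff_nonneg hs0.le hσ0.le
  have hκ1 : ∀ x, κ x ≤ 1 := outerCutoff_le_one
  have hκm : Measurable κ := measurable_outerCutoff
  have hgi : ∀ Q : Cube n, Q.toSet ⊆ U → IntegrableOn (fun x => f x * κ x) Q.toSet :=
    fun Q hQ => (hfi Q hQ).mul_bdd (c := 1) hκm.aestronglyMeasurable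
      (Eventually.of_forall fun x => by rw [Real.norm_of_nonneg (hκ0 x)]; exact hκ1 x)
  have hgf : ∀ x, |f x * κ x| ≤ |f x| := fun x => by
    rw [abs_mul, abs_of_nonneg (hκ0 x)]
    exact mul_le_of_le_one_right (abs_nonneg _) (hκ1 x)
  have hlayer : ∀ Q : Cube n, Q.toSet ⊆ U → (∀ x ∈ Q.toSet, dist x 0 ≤ R₀ + 2 * lam) →
      ρ ≤ Q.half → Q.avgAbs (fun x => f x * κ x) ≤ η := by
    intro Q hQ hR hρQ
    refine (avgAbs_le_of_eq_zero_of_le_distBd hU hne hτ hC hQ (hfi Q hQ) hlog (hgi Q hQ)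
      (fun x _ => hgf x) (fun x hx hd => ?_) (by linarith)).trans (le_trans ?_ hτη.le)
    · rw [hκ, outerCutoff_eq_zero hτ hd (hR x hx), mul_zero]
    · have := one_le_logWeight hτ.le
      gcongr
  have hgood : ∀ Q : Cube n, Q.toSet ⊆ U → Q.side < lam → Q.osc f ≤ η →
      Q.osc (fun x => f x * κ x) ≤ 4 * η := by
    intro Q hQ hside hosc
    have hh := Q.half_pos
    have hhl : Q.half ≤ lam := by rw [Cube.side] at hside; linarith
    refine (Q.osc_mul_le (hfi Q hQ) hκm hκ0 hκ1 (hgi Q hQ) (κ Q.center)).trans ?_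
    have h1 := hκosc U s σ τ (R₀ + 2 * lam) Q hU hne hs0.le hσ0.le hQ
    have h2 := (Q.abs_avg_le f).trans (hlog Q hQ)
    have h3 : 0 ≤ ∫ x, |κ x - κ Q.center| ∂Q.unif := integral_nonneg fun x => abs_nonneg _
    have h4 : |Q.avg f| * ∫ x, |κ x - κ Q.center| ∂Q.unif ≤ η := by
      calc _ ≤ C * logWeight Q.half * ∫ x, |κ x - κ Q.center| ∂Q.unif := by gcongr
        _ = C * ((∫ x, |κ x - κ Q.center| ∂Q.unif) * logWeight Q.half) := by ring
        _ ≤ C * (s * B + σ * (Q.half + 1)) := by gcongr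
        _ ≤ C * (s * B + σ * (lam + 1)) := by gcongr
        _ ≤ η := hsσ
    linarith
  refine ⟨s, σ, τ, R₀ + 2 * lam, hs0, hσ0, fun Q hQ => ⟨hgi Q hQ, fun hside => ?_, fun hside => ?_⟩⟩
  · have hhl : Q.half ≤ lam := by
      have := Q.half_pos
      rw [Cube.side] at hside
      linarith
    rcases Cube.subset_diff_closedBall_or hQ R₀ hhl with h | hR
    · exact hgood Q hQ hside ((hinf Q h).1 hside)
    by_cases hin : ∃ y ∈ Q.toSet, t₀ ≤ distBd U y
    · obtain ⟨y, hy, hyt⟩ := hin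
      refine (Q.osc_le_two_mul_avgAbs (hgi Q hQ)).trans ?_
      rcases le_total ρ Q.half with hρQ | hρQ
      · linarith [hlayer Q hQ hR hρQ]
      · rw [Q.avgAbs_congr (G := fun _ => 0) fun x hx => ?_]
        · simp only [Cube.avgAbs_eq, abs_zero, integral_zero]
          linarith
        · have h1 := distBd_le_add U y x
          have h2 := Cube.dist_le_of_mem hy hx
          rw [hκ, outerCutoff_eq_zero hτ (by linarith) (hR x hx), mul_zero]
    · push Not at hin
      exact hgood Q hQ hside (hbd Q (fun y hy => ⟨hQ hy, fun h => (hin y hy).not_ge h.2⟩) hside)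
  · refine Cube.avgAbs_le_of_grid hlam hQ (hgi Q hQ) hside fun P hPU _ hPs hPh => ?_
    rcases Cube.subset_diff_closedBall_or hPU R₀ hPh with h | hR
    · exact (Cube.integral_unif_mono P (hgi P hPU).abs (hfi P hPU).abs fun x _ => hgf x).trans
        ((hinf P h).2 hPs)
    · refine hlayer P hPU hR ((min_le_right _ _).trans ?_)
      rw [Cube.side] at hPs
      linarith

lemma MemBmo.exists_compactSupport_approx (hn : 0 < n) {U : Set (Fin n → ℝ)} (hU : IsOpen U)
    (hne : (frontier U).Nonempty) {f : (Fin n → ℝ) → ℝ} {lam C η : ℝ} (hlam : 0 < lam)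
    (hf : MemBmo U lam f) (hC : 0 ≤ C)
    (hlog : ∀ Q : Cube n, Q.toSet ⊆ U → Q.avgAbs f ≤ C * logWeight Q.half)
    (hbd : VanishAtBoundary U lam f) (hinf : VanishAtInfinity U lam f) (hη : 0 < η) :
    ∃ g : (Fin n → ℝ) → ℝ, (MemBmo U lam g ∧ IsCompact (tsupport g) ∧ tsupport g ⊆ U) ∧
      bmoNorm U lam (f - g) ≤ 5 * η := by
  obtain ⟨R₀, hR₀⟩ := (hinf.eventually_lt_const hη).exists
  obtain ⟨t₀, ht₀η, ht₀⟩ := ((hbd.eventually_lt_const hη).and self_mem_nhdsWithin).exists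
  have hfR := hf.mono_set (Set.sdiff_subset : U \ closedBall 0 R₀ ⊆ U)
  have hft := hf.mono_set (Set.sdiff_subset : U \ innerPart U t₀ ⊆ U)
  obtain ⟨s, σ, τ, R, hs, hσ, hκ⟩ := exists_outerCutoff_approx hn hU hne hlam hC hη ht₀
    hf.1 hlog
    (fun Q hQ => ⟨fun h => ((hfR.osc_le hQ h).trans (omegaOn_le_bmoNorm _ _ _)).trans hR₀.le,
      fun h => ((hfR.avgAbs_le hQ h).trans (bigAvgSup_le_bmoNorm _ _ _)).trans hR₀.le⟩)
    (fun Q hQ h => ((hft.osc_le hQ h).trans (omegaOn_le_bmoNorm _ _ _)).trans ht₀η.le)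
  set κ := outerCutoff U s σ τ R
  have hfκ : MemBmo U lam fun x => f x * κ x := by
    refine ⟨fun Q hQ => (hκ Q hQ).1, ⟨4 * η, ?_⟩, ⟨η, ?_⟩⟩
    · rintro _ ⟨Q, h1, h2, rfl⟩
      exact (hκ Q h1).2.1 h2
    · rintro _ ⟨Q, h1, h2, rfl⟩
      exact (hκ Q h1).2.2 h2
  obtain ⟨t, R', ht, hsupp⟩ := exists_support_one_sub_outerCutoff_subset hU hne hs hσ τ R
  set Z := (closure U ∩ {x | t ≤ distBd U x}) ∩ closedBall 0 R'
  have hZ : IsCompact Z := isCompact_closure_inter_le_distBd U t R'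
  have hgZ : tsupport (U.indicator fun x => f x * (1 - κ x)) ⊆ Z := by
    refine closure_minimal (fun x hx => ?_) hZ.isClosed
    have hxU : x ∈ U := Set.mem_of_indicator_ne_zero hx
    have hne1 : κ x ≠ 1 := fun h => hx (by simp [hxU, h])
    obtain ⟨h1, h2⟩ := hsupp x hxU hne1
    exact ⟨⟨subset_closure hxU, h1⟩, h2⟩
  refine ⟨U.indicator fun x => f x * (1 - κ x), ⟨(hf.sub hfκ).congr fun x hx => ?_,
    hZ.of_isClosed_subset (isClosed_tsupport _) hgZ,
    hgZ.trans (Set.inter_subset_left.trans (closure_inter_le_distBd_subset ht))⟩, ?_⟩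
  · rw [Set.indicator_of_mem hx, Pi.sub_apply]
    ring
  · rw [bmoNorm_congr (g := fun x => f x * κ x) fun x hx => by
      rw [Pi.sub_apply, Set.indicator_of_mem hx]; ring]
    have := bmoNorm_le (a := 4 * η) (b := η) (by positivity) hη.le
      (fun Q hQ => (hκ Q hQ).2.1) fun Q hQ => (hκ Q hQ).2.2
    linarith

/-- On an (ε,δ)-domain with λ = λ_{ε,δ}: f ∈ bmo_λ(Ω) is a bmo_λ(Ω)-limit of bmo functions
with compact support in Ω iff f vanishes at the boundary and at infinity. -/
theorem stmt15 {n : ℕ} (hn : 0 < n) (ε δ : ℝ) (hε : 0 < ε) (hε1 : ε ≤ 1) (hδ : 0 < δ)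
    (Ω : Set (Fin n → ℝ)) (hΩ : IsRealDomain Ω) (hed : IsEpsDeltaDomain Ω ε δ)
    (f : (Fin n → ℝ) → ℝ) (hf : MemBmo Ω (lamED n ε δ) f) :
    (∃ F : ℕ → (Fin n → ℝ) → ℝ,
        (∀ k, MemBmo Ω (lamED n ε δ) (F k) ∧ IsCompact (tsupport (F k)) ∧
          tsupport (F k) ⊆ Ω) ∧
        Tendsto (fun k => bmoNorm Ω (lamED n ε δ) (f - F k)) atTop (nhds 0)) ↔
      (VanishAtBoundary Ω (lamED n ε δ) f ∧ VanishAtInfinity Ω (lamED n ε δ) f) := by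
  have hne : (frontier Ω).Nonempty := IsEpsDeltaDomain.frontier_nonempty hn hε hδ hΩ hed
  constructor
  · rintro ⟨F, hF, hlim⟩
    exact ⟨vanishAtBoundary_of_tendsto hΩ.1 hne hf (fun k => (hF k).1) (fun k => (hF k).2.1)
      (fun k => (hF k).2.2) hlim,
      vanishAtInfinity_of_tendsto hf (fun k => (hF k).1) (fun k => (hF k).2.1) hlim⟩
  · rintro ⟨hbd, hinf⟩
    obtain ⟨C, hC, hosc, hbig⟩ := hf.exists_oscBound
    obtain ⟨C₀, hC₀, hlog⟩ :=
      OscBound.exists_avgAbs_le_logWeight hn hΩ hε hε1 hδ hed hC hosc hbig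
    choose F hF hFη using fun k : ℕ => hf.exists_compactSupport_approx hn hΩ.1 hne
      (lamED_pos hn hε hδ) hC₀ hlog hbd hinf (Nat.one_div_pos_of_nat (α := ℝ) (n := k))
    refine ⟨F, hF, squeeze_zero (fun k => bmoNorm_nonneg _ _ _) hFη ?_⟩
    have := (tendsto_one_div_add_atTop_nhds_zero_nat (𝕜 := ℝ)).const_mul 5
    rwa [mul_zero] at this
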